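/- arXiv:2603.11670 — 14 statements merged into one kernel-verified Lean document; each statement's English description precedes it below -/
import Mathlib

section
/- Let F be a field of characteristic zero, K ⊆ F a subfield, and Y ∈ F with Y ∉ K. Let r, s, r', s', a ∈ K with r ≠ 0 and r' ≠ 0, and suppose that r·Y + s = a + (r'·Y + s')⁻¹ (note r'·Y + s' ≠ 0 automatically since Y ∉ K and r' ≠ 0). Then r·(−Y) + s = a + (r'·(−Y) + s')⁻¹ holds if and only if r' = r·((r')²·Y² − (s')²). -/
theorem linear_ne_zero_of_notMem {F : Type*} [Field F] {K : Subfield F} {y c d : F}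
    (hy : y ∉ K) (hc : c ∈ K) (hd : d ∈ K) (hc0 : c ≠ 0) : c * y + d ≠ 0 := by
  intro h
  have hy_eq : y = -d / c := by
    rw [eq_div_iff hc0]
    linear_combination h
  exact hy (hy_eq ▸ K.div_mem (K.neg_mem hd) hc)

/-- Lemma 3.2 of the paper: the condition for the continued-fraction step to be
compatible with the Galois symmetry `Y ↦ −Y`. -/
theorem galois_step_iff
    (F : Type*) [Field F] [CharZero F] (K : Subfield F)
    (Y : F) (hY : Y ∉ K)
    (r s r' s' a : F)
    (hrK : r ∈ K) (hsK : s ∈ K) (hr'K : r' ∈ K) (hs'K : s' ∈ K) (haK : a ∈ K)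
    (hr : r ≠ 0) (hr' : r' ≠ 0)
    (heq : r * Y + s = a + (r' * Y + s')⁻¹) :
    (r * (-Y) + s = a + (r' * (-Y) + s')⁻¹) ↔ r' = r * (r' ^ 2 * Y ^ 2 - s' ^ 2) := by
  have hY0 : Y ≠ 0 := fun h => hY (h ▸ K.zero_mem)
  have hP : r' * Y + s' ≠ 0 := linear_ne_zero_of_notMem hY hr'K hs'K hr'
  have hQ : r' * (-Y) + s' ≠ 0 :=
    linear_ne_zero_of_notMem (fun h => hY (neg_mem_iff.mp h)) hr'K hs'K hr'
  have hstep : (r * Y + s - a) * (r' * Y + s') = 1 := by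
    rw [heq, add_sub_cancel_left, inv_mul_cancel₀ hP]
  rw [← sub_eq_iff_eq_add', ← mul_eq_one_iff_eq_inv₀ hQ]
  constructor
  · intro hconj
    apply mul_left_cancel₀ (mul_ne_zero two_ne_zero hY0)
    linear_combination (r' * (-Y) + s') * hstep - (r' * Y + s') * hconj
  · intro h
    apply mul_left_cancel₀ hP
    linear_combination (r' * (-Y) + s') * hstep - 2 * Y * h
end

section
/- Let F be a field of characteristic zero, K ⊆ F a subfield, and Y ∈ F with Y ∉ K. Let r_n, s_n, a_n ∈ K (n ∈ ℕ) with r_n ≠ 0 for all n, set Y_n := r_n·Y + s_n, and suppose Y_n = a_n + (Y_{n+1})⁻¹ for every n ∈ ℕ. Define the 2×2 matrices over F: M_n := [[0, 1], [1, −a_n]] and L_n := [[s_n/r_n, (r_n²·Y² − s_n²)/r_n], [1/r_n, −s_n/r_n]]. Then the condition r_{n+1} = r_n·(r_{n+1}²·Y² − s_{n+1}²) holds for every n ∈ ℕ if and only if the Lax compatibility condition L_{n+1}·M_n = M_n·L_n holds for every n ∈ ℕ. -/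
/-- If `Y ∉ K`, a polynomial of degree at most one over `K` vanishing at `Y` has zero
linear coefficient. -/
theorem Subfield.eq_zero_of_mul_add_eq_zero {F : Type*} [Field F] {K : Subfield F}
    {Y b c : F} (hY : Y ∉ K) (hb : b ∈ K) (hc : c ∈ K) (h : b * Y + c = 0) : b = 0 := by
  by_contra hb0
  refine hY ?_
  have hYeq : Y = -c / b := by
    rw [eq_div_iff hb0]
    linear_combination h
  rw [hYeq]
  exact K.div_mem (K.neg_mem hc) hb

/-- If `Y ∉ K` and `Y ^ 2 ∈ K`, then `1` and `Y` are linearly independent, which splits one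
continued-fraction step into its linear part and its constant part. -/
theorem continuedFraction_step_coeffs {F : Type*} [Field F] {K : Subfield F}
    {Y r s a r' s' : F} (hY : Y ∉ K) (hr : r ∈ K) (hs : s ∈ K) (ha : a ∈ K)
    (hr' : r' ∈ K) (hs' : s' ∈ K) (hr'0 : r' ≠ 0) (hYsq : Y ^ 2 ∈ K)
    (hstep : r * Y + s = a + (r' * Y + s')⁻¹) :
    r * s' = r' * (a - s) ∧ r * r' * Y ^ 2 = 1 + (a - s) * s' := by
  have hne : r' * Y + s' ≠ 0 := fun h =>
    hr'0 (Subfield.eq_zero_of_mul_add_eq_zero hY hr' hs' h)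
  have hmul : (r * Y + s - a) * (r' * Y + s') = 1 := by
    rw [hstep, add_sub_cancel_left, inv_mul_cancel₀ hne]
  have hlin : r * s' + (s - a) * r' = 0 := by
    refine Subfield.eq_zero_of_mul_add_eq_zero (c := r * r' * Y ^ 2 + (s - a) * s' - 1) hY
      (K.add_mem (K.mul_mem hr hs') (K.mul_mem (K.sub_mem hs ha) hr'))
      (K.sub_mem (K.add_mem (K.mul_mem (K.mul_mem hr hr') hYsq)
        (K.mul_mem (K.sub_mem hs ha) hs')) K.one_mem) ?_
    linear_combination hmul
  exact ⟨by linear_combination hlin, by linear_combination hmul - Y * hlin⟩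


/-- Theorem 3.3 of the paper: the condition
`r_{n+1} = r_n (r_{n+1}² Y² − s_{n+1}²)` for all `n` is equivalent to the Lax compatibility
condition `L_{n+1} M_n = M_n L_n` for all `n`. -/
theorem lax_compatibility_iff
    (F : Type*) [Field F] [CharZero F] (K : Subfield F)
    (Y : F) (hY : Y ∉ K)
    (r s a : ℕ → F)
    (hmem : ∀ n : ℕ, r n ∈ K ∧ s n ∈ K ∧ a n ∈ K)
    (hr : ∀ n : ℕ, r n ≠ 0)
    (hstep : ∀ n : ℕ, r n * Y + s n = a n + (r (n + 1) * Y + s (n + 1))⁻¹) :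
    (∀ n : ℕ, r (n + 1) = r n * ((r (n + 1)) ^ 2 * Y ^ 2 - (s (n + 1)) ^ 2)) ↔
    (∀ n : ℕ,
      (!![s (n + 1) / r (n + 1), ((r (n + 1)) ^ 2 * Y ^ 2 - (s (n + 1)) ^ 2) / r (n + 1);
          1 / r (n + 1), -(s (n + 1) / r (n + 1))] : Matrix (Fin 2) (Fin 2) F) *
        !![0, 1; 1, -(a n)] =
      (!![0, 1; 1, -(a n)] : Matrix (Fin 2) (Fin 2) F) *
        !![s n / r n, ((r n) ^ 2 * Y ^ 2 - (s n) ^ 2) / r n; 1 / r n, -(s n / r n)]) := by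
  refine forall_congr' fun n => ?_
  obtain ⟨hrK, hsK, haK⟩ := hmem n
  obtain ⟨hrK', hsK', -⟩ := hmem (n + 1)
  have hr0 := hr n
  have hr0' := hr (n + 1)
  constructor
  · intro h
    have hYsq : Y ^ 2 ∈ K := by
      have hYsq_eq : Y ^ 2 = (r (n + 1) / r n + s (n + 1) ^ 2) / r (n + 1) ^ 2 := by
        field_simp
        linear_combination -h
      rw [hYsq_eq]
      exact K.div_mem (K.add_mem (K.div_mem hrK' hrK) (K.pow_mem hsK' 2)) (K.pow_mem hrK' 2)
    obtain ⟨hlin, hconst⟩ := continuedFraction_step_coeffs hY hrK hsK haK hrK' hsK' hr0' hYsq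
      (hstep n)
    have hD : (r (n + 1) ^ 2 * Y ^ 2 - s (n + 1) ^ 2) / r (n + 1) = 1 / r n := by
      rw [div_eq_div_iff hr0' hr0]
      linear_combination -h
    have hS : s (n + 1) / r (n + 1) = (a n - s n) / r n := by
      rw [div_eq_div_iff hr0' hr0]
      linear_combination hlin
    have htr : 1 / r (n + 1) + s (n + 1) / r (n + 1) * a n =
        (r n ^ 2 * Y ^ 2 - s n ^ 2) / r n + a n * (s n / r n) := by
      field_simp
      linear_combination s n * hlin - r n * hconst
    rw [Matrix.mul_fin_two, Matrix.mul_fin_two, hD]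
    congr 1
    ext i j
    fin_cases i <;> fin_cases j
    · simp
    · simp [hS]
      ring
    · simp [hS]
      ring
    · simp
      linear_combination htr
  · intro h
    have h00 := congrFun (congrFun h 0) 0
    simp only [Matrix.mul_fin_two, Matrix.of_apply, Matrix.cons_val_zero] at h00
    field_simp at h00
    linear_combination -h00
end

section
/- For every n ∈ ℤ: Y_{n+1} ≠ 0, the continued-fraction step Y_n = a_n + (Y_{n+1})⁻¹ holds in ℂ((t)), and Y_n − a_n has t-adic order ≥ 1 (so a_n is the polynomial part of Y_n in X = t⁻¹; consequently Y_n has the infinite continued fraction expansion ⟨a_n, a_{n+1}, a_{n+2}, …⟩ with linear partial quotients, i.e. Y_n is J-expressible). -/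
theorem HahnSeries.coeff_eq_zero_of_mul_of_coeff_ne_zero {R : Type*} [Semiring R] [NoZeroDivisors R]
    {a b : LaurentSeries R} {m j : ℤ} (ha : a.coeff j ≠ 0)
    (hab : ∀ k < m, (a * b).coeff k = 0) {k : ℤ} (hk : k + j < m) : b.coeff k = 0 := by
  by_contra hb
  have ha0 : a ≠ 0 := by rintro rfl; simp at ha
  have hb0 : b ≠ 0 := by rintro rfl; simp at hb
  have hmul := HahnSeries.order_mul ha0 hb0
  have hja := HahnSeries.order_le_of_coeff_ne_zero ha
  have hkb := HahnSeries.order_le_of_coeff_ne_zero hb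
  exact HahnSeries.coeff_order_eq_zero.not.mpr (mul_ne_zero ha0 hb0) (hab _ (by omega))

/-- Lemma 3.4 of the paper, genus 1: the hyperelliptic functions `Y_n`
satisfy the forward continued-fraction recursion with linear partial quotients `a_n`,
so each `Y_n` is J-expressible. -/
theorem genus_one_forward_cf
    (f u v : ℂ) (d vv uu : ℤ → ℂ) (Y : LaurentSeries ℂ)
    (hns : ¬ ∃ p : Polynomial ℂ,
      (Polynomial.X ^ 2 + Polynomial.C f) ^ 2 +
        Polynomial.C (4 * u) * (Polynomial.X - Polynomial.C v) = p ^ 2)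
    (hY : Y ^ 2 =
      ((HahnSeries.single (-2 : ℤ) (1 : ℂ) : LaurentSeries ℂ) + HahnSeries.C f) ^ 2 +
        HahnSeries.C (4 * u) *
          ((HahnSeries.single (-1 : ℤ) (1 : ℂ) : LaurentSeries ℂ) - HahnSeries.C v))
    (hYnorm : ((HahnSeries.single (2 : ℤ) (1 : ℂ) : LaurentSeries ℂ) * Y).coeff 0 = 1)
    (hd0 : ∀ n : ℤ, d n ≠ 0)
    (hdrec : ∀ n : ℤ, d (n + 1) = -d n - (vv n) ^ 2 - f)
    (hvrec : ∀ n : ℤ, vv (n + 1) = u / d (n + 1) - vv n)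
    (hH : ∀ n : ℤ, (d n) ^ 2 + f * d n + d n * (vv n) ^ 2 - u * vv n = -(u * v))
    (hu0 : ∀ n : ℤ, uu n ≠ 0)
    (hurec : ∀ n : ℤ, uu n * uu (n - 1) = -4 * d n)
    (Yseq Ytil Ystar aseq : ℤ → LaurentSeries ℂ)
    (hYseq : ∀ n : ℤ, Yseq n =
      (Y + HahnSeries.single (-2 : ℤ) (1 : ℂ) + HahnSeries.C f + HahnSeries.C (2 * d n)) /
        (HahnSeries.C (uu n) *
          (HahnSeries.single (-1 : ℤ) (1 : ℂ) - HahnSeries.C (vv n))))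
    (hYtil : ∀ n : ℤ, Ytil n =
      (Y + HahnSeries.single (-2 : ℤ) (1 : ℂ) + HahnSeries.C f + HahnSeries.C (2 * d n)) /
        (HahnSeries.C (uu (n - 1)) *
          (HahnSeries.single (-1 : ℤ) (1 : ℂ) - HahnSeries.C (vv (n - 1)))))
    (hYstar : ∀ n : ℤ, Ystar n =
      (-Y + HahnSeries.single (-2 : ℤ) (1 : ℂ) + HahnSeries.C f + HahnSeries.C (2 * d n)) /
        (HahnSeries.C (uu n) *
          (HahnSeries.single (-1 : ℤ) (1 : ℂ) - HahnSeries.C (vv n))))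
    (haseq : ∀ n : ℤ, aseq n =
      HahnSeries.C (2 / uu n) *
        (HahnSeries.single (-1 : ℤ) (1 : ℂ) + HahnSeries.C (vv n)))
    :
    ∀ n : ℤ, Yseq (n + 1) ≠ 0 ∧
      Yseq n = aseq n + (Yseq (n + 1))⁻¹ ∧
      (∀ k : ℤ, k ≤ 0 → (Yseq n - aseq n).coeff k = 0) := by
  intro n
  have hprod_poly : ∀ x y : LaurentSeries ℂ,
      y ^ 2 = (x ^ 2 + HahnSeries.C f) ^ 2 + HahnSeries.C (4 * u) * (x - HahnSeries.C v) →
      (y - x ^ 2 - HahnSeries.C f - HahnSeries.C (2 * d (n + 1))) *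
          (y + x ^ 2 + HahnSeries.C f + HahnSeries.C (2 * d (n + 1))) =
        (HahnSeries.C (uu n) * (x - HahnSeries.C (vv n))) *
          (HahnSeries.C (uu (n + 1)) * (x - HahnSeries.C (vv (n + 1)))) := by
    intro x y hy
    have hu : HahnSeries.C (Γ := ℤ) (uu (n + 1)) * HahnSeries.C (uu n) =
        -4 * HahnSeries.C (d (n + 1)) := by
      have := congrArg (HahnSeries.C (Γ := ℤ)) (hurec (n + 1))
      simpa only [add_sub_cancel_right, map_mul, map_neg, map_ofNat] using this
    have hv : HahnSeries.C (Γ := ℤ) (d (n + 1)) *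
        (HahnSeries.C (vv (n + 1)) + HahnSeries.C (vv n)) = HahnSeries.C u := by
      rw [← map_add, ← map_mul, hvrec n, sub_add_cancel, mul_div_cancel₀ _ (hd0 _)]
    have hH' := congrArg (HahnSeries.C (Γ := ℤ)) (hH (n + 1))
    simp only [map_mul, map_neg, map_add, map_sub, map_pow, map_ofNat] at hy hH' ⊢
    linear_combination hy - (x - HahnSeries.C (vv n)) * (x - HahnSeries.C (vv (n + 1))) * hu
      - 4 * hH' + (4 * HahnSeries.C (vv (n + 1)) - 4 * x) * hv
  have hX : (HahnSeries.single (-2 : ℤ) (1 : ℂ) : LaurentSeries ℂ) =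
      HahnSeries.single (-1 : ℤ) (1 : ℂ) ^ 2 := by
    simp [HahnSeries.single_pow]
  have hlin_coeff : ∀ c : ℂ, ((HahnSeries.single (-1 : ℤ) (1 : ℂ) : LaurentSeries ℂ) -
      HahnSeries.C c).coeff (-1) = 1 := by
    intro c
    simp [HahnSeries.C_apply, HahnSeries.coeff_single_of_ne]
  have hden_coeff : ∀ m : ℤ, (HahnSeries.C (uu m) *
      ((HahnSeries.single (-1 : ℤ) (1 : ℂ) : LaurentSeries ℂ) -
        HahnSeries.C (vv m))).coeff (-1) ≠ 0 := by
    intro m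
    rw [HahnSeries.C_mul_eq_smul, HahnSeries.coeff_smul, hlin_coeff]
    simpa using hu0 m
  have hden : ∀ m : ℤ, HahnSeries.C (uu m) *
      ((HahnSeries.single (-1 : ℤ) (1 : ℂ) : LaurentSeries ℂ) - HahnSeries.C (vv m)) ≠ 0 :=
    fun m h => hden_coeff m (by rw [h, HahnSeries.coeff_zero])
  have hdiff : HahnSeries.C (uu n) * (HahnSeries.single (-1 : ℤ) (1 : ℂ) - HahnSeries.C (vv n)) *
      (Yseq n - aseq n) = Y - HahnSeries.single (-2 : ℤ) (1 : ℂ) - HahnSeries.C f -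
        HahnSeries.C (2 * d (n + 1)) := by
    have ha : HahnSeries.C (Γ := ℤ) (uu n) * HahnSeries.C (2 / uu n) = 2 := by
      rw [← map_mul, mul_div_cancel₀ _ (hu0 n), map_ofNat]
    rw [mul_sub, hYseq n, mul_div_cancel₀ _ (hden n), haseq n, hdrec n, hX]
    simp only [map_mul, map_neg, map_sub, map_pow, map_ofNat]
    linear_combination -(HahnSeries.single (-1 : ℤ) (1 : ℂ) - HahnSeries.C (vv n)) *
      (HahnSeries.single (-1 : ℤ) (1 : ℂ) + HahnSeries.C (vv n)) * ha
  have hone : (Yseq n - aseq n) * Yseq (n + 1) = 1 := by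
    apply mul_left_cancel₀ (mul_ne_zero (hden n) (hden (n + 1)))
    rw [mul_mul_mul_comm, hdiff, hYseq (n + 1), mul_div_cancel₀ _ (hden (n + 1)), mul_one, hX]
    exact hprod_poly _ _ (by rw [hY, hX])
  refine ⟨right_ne_zero_of_mul_eq_one hone, ?_, fun k hk => ?_⟩
  · rw [← eq_inv_of_mul_eq_one_left hone, add_sub_cancel]
  have hYcoeff : Y.coeff (-2) = 1 := by
    have := HahnSeries.coeff_single_mul_add (r := (1 : ℂ)) (x := Y) (a := -2) (b := 2)
    simpa [hYnorm] using this.symm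
  have hsum : (Y + HahnSeries.single (-2 : ℤ) (1 : ℂ) + HahnSeries.C f).coeff (-2) ≠ 0 := by
    simp [hYcoeff, HahnSeries.C_apply, HahnSeries.coeff_single_of_ne]
  have hfac : (Y + HahnSeries.single (-2 : ℤ) (1 : ℂ) + HahnSeries.C f) *
      (Y - HahnSeries.single (-2 : ℤ) (1 : ℂ) - HahnSeries.C f) =
      HahnSeries.C (4 * u) * (HahnSeries.single (-1 : ℤ) (1 : ℂ) - HahnSeries.C v) := by
    linear_combination hY
  have hconj : ∀ i : ℤ, i < 1 →
      (Y - HahnSeries.single (-2 : ℤ) (1 : ℂ) - HahnSeries.C f).coeff i = 0 := by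
    intro i hi
    refine HahnSeries.coeff_eq_zero_of_mul_of_coeff_ne_zero (m := -1) hsum (fun j hj => ?_)
      (by omega)
    rw [hfac, HahnSeries.C_mul_eq_smul, HahnSeries.coeff_smul, HahnSeries.coeff_sub,
      HahnSeries.C_apply, HahnSeries.coeff_single_of_ne (by omega),
      HahnSeries.coeff_single_of_ne (by omega), sub_zero, smul_zero]
  refine HahnSeries.coeff_eq_zero_of_mul_of_coeff_ne_zero (m := 0) (hden_coeff n)
    (fun j hj => ?_) (by omega)
  rw [hdiff, HahnSeries.coeff_sub, hconj j (by omega), HahnSeries.C_apply,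
    HahnSeries.coeff_single_of_ne (by omega), sub_zero]
end

section
/- For every n ∈ ℤ: Ỹ_{n−1} ≠ 0, the backward continued-fraction step Ỹ_n = a_{n−1} + (Ỹ_{n−1})⁻¹ holds in ℂ((t)), and Ỹ_n − a_{n−1} has t-adic order ≥ 1 (so a_{n−1} is the polynomial part of Ỹ_n in X = t⁻¹; consequently Ỹ_n has the infinite continued fraction expansion ⟨a_{n−1}, a_{n−2}, a_{n−3}, …⟩). -/
/-- A nonzero coefficient below which all coefficients vanish sits at the order. -/
lemma HahnSeries.order_eq_of_coeff {Γ R : Type*} [LinearOrder Γ] [Zero Γ] [Zero R]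
    {x : HahnSeries Γ R} {k : Γ} (hk : x.coeff k ≠ 0) (hlt : ∀ j < k, x.coeff j = 0) :
    x.order = k := by
  refine le_antisymm (order_le_of_coeff_ne_zero hk) (not_lt.1 fun h => ?_)
  have hx : x ≠ 0 := fun h0 => hk (by simp [h0])
  exact coeff_order_eq_zero.not.2 hx (hlt _ h)

/-- The backward continued-fraction step for `√((X² + f)² + 4u(X - v))`, over any field. -/
lemma sqrt_quartic_cf_step {K : Type*} [Field K] {X Y f u v d d' w w' a b : K}
    (hY : Y ^ 2 = (X ^ 2 + f) ^ 2 + 4 * u * (X - v)) (hd : d' = -d - w ^ 2 - f)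
    (hab : a * b = -4 * d) (hsum : d * (w + w') = u)
    (hprod : d * (w * w') = d ^ 2 + f * d + u * v) (ha : a ≠ 0) (hX : X - w ≠ 0)
    (hN : Y + X ^ 2 + f + 2 * d ≠ 0) :
    (Y + X ^ 2 + f + 2 * d') / (a * (X - w)) =
      2 / a * (X + w) + ((Y + X ^ 2 + f + 2 * d) / (b * (X - w')))⁻¹ := by
  rw [inv_div]
  field_simp
  linear_combination hY + 2 * (Y + X ^ 2 + f + 2 * d) * hd - (X - w) * (X - w') * hab -
    4 * X * hsum + 4 * hprod

namespace LaurentSeries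

open HahnSeries

lemma order_single_neg_one_sub_C (c : ℂ) :
    ((single (-1 : ℤ) (1 : ℂ) : LaurentSeries ℂ) - HahnSeries.C c).order = -1 := by
  apply order_eq_of_coeff
  · simp [HahnSeries.C_apply]
  · intro j hj
    simp [HahnSeries.C_apply, hj.ne, show j ≠ 0 by omega]

lemma single_neg_one_sub_C_ne_zero (c : ℂ) :
    (single (-1 : ℤ) (1 : ℂ) : LaurentSeries ℂ) - HahnSeries.C c ≠ 0 := by
  intro h
  have hord := order_single_neg_one_sub_C c
  rw [h, order_zero] at hord
  omega

lemma single_neg_two_eq_sq :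
    (single (-2 : ℤ) (1 : ℂ) : LaurentSeries ℂ) = single (-1 : ℤ) (1 : ℂ) ^ 2 := by
  rw [sq, single_mul_single]
  norm_num

/-- A square root of the quartic `(X² + f)² + 4u(X - v)` has a double pole at `X = ∞`. -/
lemma order_sqrt_quartic {f u v : ℂ} {Y : LaurentSeries ℂ}
    (hY : Y ^ 2 =
      ((single (-2 : ℤ) (1 : ℂ) : LaurentSeries ℂ) + HahnSeries.C f) ^ 2 +
        HahnSeries.C (4 * u) *
          ((single (-1 : ℤ) (1 : ℂ) : LaurentSeries ℂ) - HahnSeries.C v)) :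
    Y.order = -2 := by
  have hexp : Y ^ 2 = single (-4 : ℤ) (1 : ℂ) + single (-2 : ℤ) (2 * f) +
      single (-1 : ℤ) (4 * u) + single (0 : ℤ) (f ^ 2 - 4 * u * v) := by
    rw [hY, add_sq, mul_sub]
    simp only [HahnSeries.C_apply, sq, single_mul_single, mul_assoc, single_sub]
    rw [show (2 : LaurentSeries ℂ) = single (0 : ℤ) (2 : ℂ) from (map_ofNat HahnSeries.C 2).symm]
    simp only [single_mul_single]
    norm_num
    ring
  have hord : (Y ^ 2).order = -4 := by
    rw [hexp]
    apply order_eq_of_coeff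
    · simp
    · intro j hj
      simp [hj.ne, show j ≠ -2 by omega, show j ≠ -1 by omega,
        show j ≠ 0 by omega]
  rw [order_pow] at hord
  simp only [nsmul_eq_mul, Nat.cast_ofNat] at hord
  omega

end LaurentSeries

/-- Lemma 3.5 of the paper, genus 1: the hyperelliptic functions `Ỹ_n`
satisfy the backward continued-fraction recursion with linear partial quotients `a_{n−1}`. -/
theorem genus_one_backward_cf
    (f u v : ℂ) (d vv uu : ℤ → ℂ) (Y : LaurentSeries ℂ)
    (hns : ¬ ∃ p : Polynomial ℂ,
      (Polynomial.X ^ 2 + Polynomial.C f) ^ 2 +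
        Polynomial.C (4 * u) * (Polynomial.X - Polynomial.C v) = p ^ 2)
    (hY : Y ^ 2 =
      ((HahnSeries.single (-2 : ℤ) (1 : ℂ) : LaurentSeries ℂ) + HahnSeries.C f) ^ 2 +
        HahnSeries.C (4 * u) *
          ((HahnSeries.single (-1 : ℤ) (1 : ℂ) : LaurentSeries ℂ) - HahnSeries.C v))
    (hYnorm : ((HahnSeries.single (2 : ℤ) (1 : ℂ) : LaurentSeries ℂ) * Y).coeff 0 = 1)
    (hd0 : ∀ n : ℤ, d n ≠ 0)
    (hdrec : ∀ n : ℤ, d (n + 1) = -d n - (vv n) ^ 2 - f)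
    (hvrec : ∀ n : ℤ, vv (n + 1) = u / d (n + 1) - vv n)
    (hH : ∀ n : ℤ, (d n) ^ 2 + f * d n + d n * (vv n) ^ 2 - u * vv n = -(u * v))
    (hu0 : ∀ n : ℤ, uu n ≠ 0)
    (hurec : ∀ n : ℤ, uu n * uu (n - 1) = -4 * d n)
    (Yseq Ytil Ystar aseq : ℤ → LaurentSeries ℂ)
    (hYseq : ∀ n : ℤ, Yseq n =
      (Y + HahnSeries.single (-2 : ℤ) (1 : ℂ) + HahnSeries.C f + HahnSeries.C (2 * d n)) /
        (HahnSeries.C (uu n) *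
          (HahnSeries.single (-1 : ℤ) (1 : ℂ) - HahnSeries.C (vv n))))
    (hYtil : ∀ n : ℤ, Ytil n =
      (Y + HahnSeries.single (-2 : ℤ) (1 : ℂ) + HahnSeries.C f + HahnSeries.C (2 * d n)) /
        (HahnSeries.C (uu (n - 1)) *
          (HahnSeries.single (-1 : ℤ) (1 : ℂ) - HahnSeries.C (vv (n - 1)))))
    (hYstar : ∀ n : ℤ, Ystar n =
      (-Y + HahnSeries.single (-2 : ℤ) (1 : ℂ) + HahnSeries.C f + HahnSeries.C (2 * d n)) /
        (HahnSeries.C (uu n) *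
          (HahnSeries.single (-1 : ℤ) (1 : ℂ) - HahnSeries.C (vv n))))
    (haseq : ∀ n : ℤ, aseq n =
      HahnSeries.C (2 / uu n) *
        (HahnSeries.single (-1 : ℤ) (1 : ℂ) + HahnSeries.C (vv n)))
    :
    ∀ n : ℤ, Ytil (n - 1) ≠ 0 ∧
      Ytil n = aseq (n - 1) + (Ytil (n - 1))⁻¹ ∧
      (∀ k : ℤ, k ≤ 0 → (Ytil n - aseq (n - 1)).coeff k = 0) := by
  intro n
  obtain ⟨m, rfl⟩ : ∃ m, n = m + 1 := ⟨n - 1, by ring⟩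
  simp only [add_sub_cancel_right]
  have hdm := hdrec m
  have hvm := hvrec (m - 1)
  have hHm := hH m
  have hum := hurec m
  rw [sub_add_cancel] at hvm
  have hsum : d m * (vv m + vv (m - 1)) = u := by
    rw [hvm, sub_add_cancel, mul_div_cancel₀ _ (hd0 m)]
  have hprod : d m * (vv m * vv (m - 1)) = d m ^ 2 + f * d m + u * v := by
    linear_combination vv m * hsum - hHm
  have hC {c : ℂ} (hc : c ≠ 0) : (HahnSeries.C c : LaurentSeries ℂ) ≠ 0 := by
    simpa using hc
  have hden (k j : ℤ) := mul_ne_zero (hC (hu0 k))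
    (LaurentSeries.single_neg_one_sub_C_ne_zero (vv j))
  have hordY := LaurentSeries.order_sqrt_quartic hY
  have hlead : Y.coeff (-2) = 1 := by
    have h := HahnSeries.coeff_single_mul_add (r := (1 : ℂ)) (x := Y) (a := -2) (b := (2 : ℤ))
    simpa [hYnorm] using h.symm
  have hordnum : (Y + HahnSeries.single (-2 : ℤ) (1 : ℂ) + HahnSeries.C f +
      HahnSeries.C (2 * d m)).order = -2 := by
    apply HahnSeries.order_eq_of_coeff
    · simp [HahnSeries.C_apply, hlead]
    · intro j hj
      have hYj : Y.coeff j = 0 := HahnSeries.coeff_eq_zero_of_lt_order (by rwa [hordY])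
      simp [HahnSeries.C_apply, hYj, hj.ne, show j ≠ 0 by omega]
  have hnum : Y + HahnSeries.single (-2 : ℤ) (1 : ℂ) + HahnSeries.C f +
      HahnSeries.C (2 * d m) ≠ 0 := by
    intro h
    rw [h, HahnSeries.order_zero] at hordnum
    omega
  have hne : Ytil m ≠ 0 := by
    rw [hYtil]
    exact div_ne_zero hnum (hden _ _)
  have hord : (Ytil m).order = -1 := by
    have hmul := (eq_div_iff (hden _ _)).1 (hYtil m)
    have h := congrArg HahnSeries.order hmul
    rw [HahnSeries.order_mul hne (hden _ _), HahnSeries.order_mul (hC (hu0 _))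
      (LaurentSeries.single_neg_one_sub_C_ne_zero _), hordnum, HahnSeries.order_C,
      LaurentSeries.order_single_neg_one_sub_C] at h
    omega
  have hstep : Ytil (m + 1) = aseq m + (Ytil m)⁻¹ := by
    have hC_eq {x y : ℂ} (h : x = y) := congrArg (HahnSeries.C : ℂ →+* LaurentSeries ℂ) h
    have hdm' := hC_eq hdm
    have hum' := hC_eq hum
    have hsum' := hC_eq hsum
    have hprod' := hC_eq hprod
    rw [hYtil (m + 1), add_sub_cancel_right, haseq, hYtil m]
    rw [LaurentSeries.single_neg_two_eq_sq] at hY hnum ⊢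
    simp only [map_mul, map_add, map_sub, map_pow, map_neg, map_ofNat, map_div₀]
      at hY hnum hdm' hum' hsum' hprod' ⊢
    exact sqrt_quartic_cf_step hY hdm' hum' hsum' hprod' (hC (hu0 m))
      (LaurentSeries.single_neg_one_sub_C_ne_zero _) hnum
  refine ⟨hne, hstep, fun k hk => ?_⟩
  rw [hstep, add_sub_cancel_left]
  apply HahnSeries.coeff_eq_zero_of_lt_order
  have h := HahnSeries.order_mul hne (inv_ne_zero hne)
  rw [mul_inv_cancel₀ hne, HahnSeries.order_one, hord] at h
  omega
end

section
/- For every n ∈ ℤ, the identity Ỹ_n · Y_n* = −1 holds in ℂ((t)); that is, (Y_n, Ỹ_n) is a quadratic orthogonal pair, where Y_n* is the Galois conjugate of Y_n obtained by replacing Y with −Y. -/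
/-- In formal Laurent series, `t⁻¹ - a` is nonzero for every constant `a`. -/
theorem LaurentSeries.single_neg_one_sub_C_ne_zero_s6 {R : Type*} [Ring R] [Nontrivial R] (a : R) :
    (HahnSeries.single (-1 : ℤ) (1 : R) : LaurentSeries R) - HahnSeries.C a ≠ 0 := by
  intro h
  have h' := congrArg (fun s : LaurentSeries R => s.coeff (-1)) h
  simp [HahnSeries.C_apply, HahnSeries.coeff_single_of_ne] at h'

/-- The algebraic identity behind quadratic orthogonal pairs of genus one, in any field. -/
theorem div_mul_conj_div_eq_neg_one {K : Type*} [Field K]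
    {f u v d w w' a a' X Y : K} (hY : Y ^ 2 = (X ^ 2 + f) ^ 2 + 4 * u * (X - v))
    (hH : d ^ 2 + f * d + d * w ^ 2 - u * w = -(u * v)) (hw : d * (w + w') = u)
    (ha : a * a' = -4 * d) (ha0 : a ≠ 0) (ha0' : a' ≠ 0)
    (hX : X - w ≠ 0) (hX' : X - w' ≠ 0) :
    (Y + X ^ 2 + f + 2 * d) / (a' * (X - w')) * ((-Y + X ^ 2 + f + 2 * d) / (a * (X - w))) =
      -1 := by
  rw [div_mul_div_comm, div_eq_iff (mul_ne_zero (mul_ne_zero ha0' hX') (mul_ne_zero ha0 hX))]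
  linear_combination -hY + (X - w) * (X - w') * ha + 4 * hH + 4 * (X - w) * hw

/-- Theorem 3.6(ii) of the paper, genus 1: for every `n`, the pair
`(Y_n, Ỹ_n)` is a quadratic orthogonal pair, i.e. `Ỹ_n · Y_n* = −1`. -/
theorem genus_one_quadratic_orthogonal_pair
    (f u v : ℂ) (d vv uu : ℤ → ℂ) (Y : LaurentSeries ℂ)
    (hns : ¬ ∃ p : Polynomial ℂ,
      (Polynomial.X ^ 2 + Polynomial.C f) ^ 2 +
        Polynomial.C (4 * u) * (Polynomial.X - Polynomial.C v) = p ^ 2)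
    (hY : Y ^ 2 =
      ((HahnSeries.single (-2 : ℤ) (1 : ℂ) : LaurentSeries ℂ) + HahnSeries.C f) ^ 2 +
        HahnSeries.C (4 * u) *
          ((HahnSeries.single (-1 : ℤ) (1 : ℂ) : LaurentSeries ℂ) - HahnSeries.C v))
    (hYnorm : ((HahnSeries.single (2 : ℤ) (1 : ℂ) : LaurentSeries ℂ) * Y).coeff 0 = 1)
    (hd0 : ∀ n : ℤ, d n ≠ 0)
    (hdrec : ∀ n : ℤ, d (n + 1) = -d n - (vv n) ^ 2 - f)
    (hvrec : ∀ n : ℤ, vv (n + 1) = u / d (n + 1) - vv n)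
    (hH : ∀ n : ℤ, (d n) ^ 2 + f * d n + d n * (vv n) ^ 2 - u * vv n = -(u * v))
    (hu0 : ∀ n : ℤ, uu n ≠ 0)
    (hurec : ∀ n : ℤ, uu n * uu (n - 1) = -4 * d n)
    (Yseq Ytil Ystar aseq : ℤ → LaurentSeries ℂ)
    (hYseq : ∀ n : ℤ, Yseq n =
      (Y + HahnSeries.single (-2 : ℤ) (1 : ℂ) + HahnSeries.C f + HahnSeries.C (2 * d n)) /
        (HahnSeries.C (uu n) *
          (HahnSeries.single (-1 : ℤ) (1 : ℂ) - HahnSeries.C (vv n))))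
    (hYtil : ∀ n : ℤ, Ytil n =
      (Y + HahnSeries.single (-2 : ℤ) (1 : ℂ) + HahnSeries.C f + HahnSeries.C (2 * d n)) /
        (HahnSeries.C (uu (n - 1)) *
          (HahnSeries.single (-1 : ℤ) (1 : ℂ) - HahnSeries.C (vv (n - 1)))))
    (hYstar : ∀ n : ℤ, Ystar n =
      (-Y + HahnSeries.single (-2 : ℤ) (1 : ℂ) + HahnSeries.C f + HahnSeries.C (2 * d n)) /
        (HahnSeries.C (uu n) *
          (HahnSeries.single (-1 : ℤ) (1 : ℂ) - HahnSeries.C (vv n))))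
    (haseq : ∀ n : ℤ, aseq n =
      HahnSeries.C (2 / uu n) *
        (HahnSeries.single (-1 : ℤ) (1 : ℂ) + HahnSeries.C (vv n)))
    :
    ∀ n : ℤ, Ytil n * Ystar n = -1 := by
  intro n
  have hX2 : (HahnSeries.single (-2 : ℤ) (1 : ℂ) : LaurentSeries ℂ) =
      HahnSeries.single (-1 : ℤ) (1 : ℂ) ^ 2 := by
    simp [HahnSeries.single_pow]
  have hC0 : ∀ k, (HahnSeries.C (uu k) : LaurentSeries ℂ) ≠ 0 := fun k =>
    HahnSeries.C_ne_zero (hu0 k)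
  have hw : d n * (vv n + vv (n - 1)) = u := by
    have h := hvrec (n - 1)
    rw [sub_add_cancel] at h
    rw [h, sub_add_cancel, mul_div_cancel₀ _ (hd0 n)]
  have hHC := congrArg (HahnSeries.C : ℂ →+* LaurentSeries ℂ) (hH n)
  have hwC := congrArg (HahnSeries.C : ℂ →+* LaurentSeries ℂ) hw
  have huC := congrArg (HahnSeries.C : ℂ →+* LaurentSeries ℂ) (hurec n)
  simp only [map_add, map_sub, map_mul, map_neg, map_pow, map_ofNat] at hHC hwC huC hY
  rw [hX2] at hY
  rw [hYtil, hYstar, hX2, map_mul, map_ofNat]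
  exact div_mul_conj_div_eq_neg_one hY hHC hwC huC (hC0 n) (hC0 (n - 1))
    (LaurentSeries.single_neg_one_sub_C_ne_zero_s6 _) (LaurentSeries.single_neg_one_sub_C_ne_zero_s6 _)
end

section
/- Let f, u, v ∈ ℂ and let d_n, v_n ∈ ℂ (n ∈ ℤ) satisfy, for every n: d_n ≠ 0, d_{n+1} = −d_n − v_n² − f, v_{n+1} = u/d_{n+1} − v_n, and d_n² + f·d_n + d_n·v_n² − u·v_n = −u·v. Then for every n ∈ ℤ the identity of polynomials in ℂ[X] holds: (X²+f)² + 4u(X−v) = (X²+f+2d_n)² − 4d_n·(X−v_n)·(X−v_{n−1}). In particular, evaluating at X = v, one gets (v−v_n)(v−v_{n−1}) = d_n + v² + f. -/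
/-- the polynomial factorization identity
`(X²+f)² + 4u(X−v) = (X²+f+2dₙ)² − 4dₙ(X−vₙ)(X−v_{n−1})` along the orbit of the map `Φ`
with conserved quantity `H = −uv`, and its evaluation at `X = v`. -/
theorem curve_factorization
    (f u v : ℂ) (d vv : ℤ → ℂ)
    (hd0 : ∀ n : ℤ, d n ≠ 0)
    (hdrec : ∀ n : ℤ, d (n + 1) = -d n - (vv n) ^ 2 - f)
    (hvrec : ∀ n : ℤ, vv (n + 1) = u / d (n + 1) - vv n)
    (hH : ∀ n : ℤ, (d n) ^ 2 + f * d n + d n * (vv n) ^ 2 - u * vv n = -(u * v)) :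
    ∀ n : ℤ,
      ((Polynomial.X ^ 2 + Polynomial.C f) ^ 2 +
          Polynomial.C (4 * u) * (Polynomial.X - Polynomial.C v) : Polynomial ℂ) =
        (Polynomial.X ^ 2 + Polynomial.C f + Polynomial.C (2 * d n)) ^ 2 -
          Polynomial.C (4 * d n) * (Polynomial.X - Polynomial.C (vv n)) *
            (Polynomial.X - Polynomial.C (vv (n - 1))) ∧
      (v - vv n) * (v - vv (n - 1)) = d n + v ^ 2 + f := by
  intro n
  have hn : n - 1 + 1 = n := by ring
  have hsum : d n * (vv n + vv (n - 1)) = u := by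
    have h := hvrec (n - 1)
    rw [hn] at h
    rw [h, sub_add_cancel, mul_div_cancel₀ _ (hd0 n)]
  have hprod : d n ^ 2 + f * d n - d n * vv n * vv (n - 1) = -(u * v) := by
    linear_combination hH n - vv n * hsum
  constructor
  · have hsumC := congrArg Polynomial.C hsum
    have hprodC := congrArg Polynomial.C hprod
    simp only [map_add, map_sub, map_mul, map_neg, map_pow] at hsumC hprodC
    simp only [map_mul, map_ofNat]
    linear_combination -4 * Polynomial.X * hsumC - 4 * hprodC
  · apply mul_left_cancel₀ (hd0 n)
    linear_combination -v * hsum - hprod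
end

section
/- τ_m ≠ 0 for every m ∈ ℤ, and the single consistent formula d_m · τ_m² = τ_{m−1} · τ_{m+1} holds for every m ∈ ℤ (in particular τ_{n+1} = u_n/2 and τ_{n−1} = −u_{n−1}/2). Thus one Hankel-determinant family, defined simultaneously for all integers from the quadratic orthogonal pair (Y_n, Ỹ_n), reproduces the whole bilateral sequence {d_m}, resolving Hone's mismatch problem. -/
/-- The `k × k` Hankel determinant of a sequence. -/
def hankelDet (s : ℕ → ℂ) (k : ℕ) : ℂ :=
  Matrix.det (Matrix.of fun i j : Fin k => s (i + j))

theorem hankelDet_zero (s : ℕ → ℂ) : hankelDet s 0 = 1 :=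
  Matrix.det_fin_zero

theorem hankelDet_one (s : ℕ → ℂ) : hankelDet s 1 = s 0 := by
  simp [hankelDet]

open PowerSeries in
/-- The Hankel determinants of `g = 1 / (c⁻¹ (1 + b X) + X² h)` in terms of those of `h`. -/
theorem hankelDet_succ_of_inv (k : ℕ) (g h : PowerSeries ℂ) (c b : ℂ) (hc : c ≠ 0)
    (hgh : (C c⁻¹ * (1 + C b * X) + X ^ 2 * h) * g = 1) :
    hankelDet (fun i => coeff i g) (k + 1) =
      (-1) ^ k * c ^ (2 * k + 1) * hankelDet (fun i => coeff i h) k := by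
  set q : PowerSeries ℂ := C c⁻¹ * (1 + C b * X) + X ^ 2 * h with hq
  have q0 : coeff 0 q = c⁻¹ := by simp [hq]
  have q2 : ∀ m, coeff (m + 2) q = coeff m h := by
    intro m
    have h1 : coeff (m + 2) (C c⁻¹ * (1 + C b * X) : PowerSeries ℂ) = 0 := by
      rw [coeff_C_mul, map_add, coeff_C_mul, coeff_one, coeff_X]
      simp
    rw [hq, map_add, h1, zero_add, coeff_X_pow_mul]
  have conv : ∀ i j : ℕ, ∑ m ∈ Finset.range (i + 1), coeff (i - m) q * coeff (m + j) g =
      (if i + j = 0 then 1 else 0) -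
        ∑ p ∈ Finset.range j, coeff (i + 1 + p) q * coeff (j - 1 - p) g := by
    intro i j
    have h1 := congrArg (coeff (i + j)) hgh
    rw [coeff_mul, Finset.Nat.sum_antidiagonal_eq_sum_range_succ
      (fun a b => coeff a q * coeff b g), coeff_one,
      show (i + j).succ = (i + 1) + j by omega, Finset.sum_range_add] at h1
    rw [← h1, ← Finset.sum_range_reflect, add_sub_assoc, ← Finset.sum_sub_distrib]
    rw [Finset.sum_eq_zero (s := Finset.range j), add_zero]
    · refine Finset.sum_congr rfl fun m hm => ?_
      have := Finset.mem_range.1 hm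
      congr 3 <;> omega
    · intro p hp
      have := Finset.mem_range.1 hp
      rw [show i + j - (i + 1 + p) = j - 1 - p by omega, sub_self]
  have g0 : coeff 0 g = c := by
    have h1 := conv 0 0
    simp only [zero_add, Finset.sum_range_one, Finset.sum_range_zero, Nat.sub_self, q0,
      if_true, sub_zero, add_zero] at h1
    field_simp at h1
    exact h1
  let L : Matrix (Fin (k + 1)) (Fin (k + 1)) ℂ :=
    fun i j => if j ≤ i then coeff (i - j : ℕ) q else 0
  let H : Matrix (Fin (k + 1)) (Fin (k + 1)) ℂ := fun i j => coeff (i + j : ℕ) g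
  let U : Matrix (Fin k) (Fin k) ℂ :=
    fun i j => if i ≤ j then coeff (j - i : ℕ) g else 0
  let H' : Matrix (Fin k) (Fin k) ℂ := fun i j => coeff (i + j : ℕ) h
  have detL : L.det = c⁻¹ ^ (k + 1) := by
    rw [Matrix.det_of_isLowerTriangular]
    · simp [L, q0]
    · intro i j hij
      have : i < j := hij
      simp [L, not_le.2 this]
  have detU : U.det = c ^ k := by
    rw [Matrix.det_of_isUpperTriangular]
    · simp [U, g0]
    · intro i j hij
      have : j < i := hij
      simp [U, not_le.2 this]
  have LH : ∀ i j : Fin (k + 1), (L * H) i j = (if (i + j : ℕ) = 0 then 1 else 0) -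
        ∑ p ∈ Finset.range j, coeff (i + 1 + p) q * coeff (j - 1 - p) g := by
    intro i j
    rw [← conv, Matrix.mul_apply]
    simp only [L, H, ite_mul, zero_mul, Fin.le_def]
    rw [Fin.sum_univ_eq_sum_range (fun m => if m ≤ (i : ℕ) then
      coeff (i - m : ℕ) q * coeff (m + j : ℕ) g else 0), ← Finset.sum_filter]
    refine Finset.sum_congr ?_ fun _ _ => rfl
    ext m
    have := i.2
    simp only [Finset.mem_filter, Finset.mem_range]
    omega
  have sub : (L * H).submatrix Fin.succ Fin.succ = -(H' * U) := by
    ext i j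
    rw [Matrix.submatrix_apply, LH, Matrix.neg_apply, Matrix.mul_apply]
    simp only [U, H', mul_ite, mul_zero, Fin.le_def]
    rw [Fin.sum_univ_eq_sum_range (fun m => if m ≤ (j : ℕ) then
      coeff (i + m : ℕ) h * coeff (j - m : ℕ) g else 0), ← Finset.sum_filter,
      if_neg (by simp), zero_sub, neg_inj]
    refine Finset.sum_congr ?_ fun p _ => ?_
    · ext m
      have := j.2
      simp only [Finset.mem_filter, Finset.mem_range, Fin.val_succ]
      omega
    · rw [← q2, Fin.val_succ, Fin.val_succ]
      congr 3
      omega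
  have key : (L * H).det = (-1) ^ k * (H'.det * c ^ k) := by
    rw [Matrix.det_succ_column_zero, Fin.sum_univ_succ, Finset.sum_eq_zero, add_zero]
    · have : (L * H).submatrix (Fin.succAbove 0) Fin.succ = -(H' * U) := by
        rw [← sub]; rfl
      rw [this, Matrix.det_neg, Matrix.det_mul, detU, LH]
      simp
    · intro i _
      rw [LH]
      simp
  rw [Matrix.det_mul, detL] at key
  change H.det = (-1) ^ k * c ^ (2 * k + 1) * H'.det
  rw [inv_pow, inv_mul_eq_iff_eq_mul₀ (pow_ne_zero _ hc)] at key
  rw [key]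
  ring

/-- Hankel determinants of a J-fraction: if `g m = 1 / ((c m)⁻¹ (1 + b m X) + X² g (m + 1))`
with all `c m` nonzero, then no Hankel determinant of `g m` vanishes, and consecutive ones
satisfy a three-term relation. -/
theorem hankelDet_jfraction (g : ℕ → PowerSeries ℂ) (c b : ℕ → ℂ) (hc : ∀ m, c m ≠ 0)
    (hg : ∀ m, (PowerSeries.C (c m)⁻¹ * (1 + PowerSeries.C (b m) * PowerSeries.X) +
      PowerSeries.X ^ 2 * g (m + 1)) * g m = 1) (k m : ℕ) :
    hankelDet (fun i => (g m).coeff i) k ≠ 0 ∧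
    -(c (m + k) * c (m + k + 1)) * hankelDet (fun i => (g m).coeff i) (k + 1) ^ 2 =
      hankelDet (fun i => (g m).coeff i) k * hankelDet (fun i => (g m).coeff i) (k + 2) := by
  induction k generalizing m with
  | zero =>
    simp only [hankelDet_succ_of_inv _ _ _ _ _ (hc _) (hg _), hankelDet_zero]
    refine ⟨one_ne_zero, ?_⟩
    ring_nf
  | succ k ih =>
    obtain ⟨h1, h2⟩ := ih (m + 1)
    rw [hankelDet_succ_of_inv (k + 2) _ _ _ _ (hc m) (hg m),
      hankelDet_succ_of_inv (k + 1) _ _ _ _ (hc m) (hg m),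
      hankelDet_succ_of_inv k _ _ _ _ (hc m) (hg m)]
    refine ⟨mul_ne_zero (mul_ne_zero (by simp) (pow_ne_zero _ (hc m))) h1, ?_⟩
    rw [show m + 1 + k = m + (k + 1) by omega] at h2
    linear_combination ((-1 : ℂ) ^ k) ^ 2 * c m ^ (4 * k + 6) * h2

theorem exists_powerSeries_sqrt (Y : LaurentSeries ℂ) (P : PowerSeries ℂ)
    (hY : (HahnSeries.single (2 : ℤ) (1 : ℂ) * Y) ^ 2 = HahnSeries.ofPowerSeries ℤ ℂ P)
    (h1 : (HahnSeries.single (2 : ℤ) (1 : ℂ) * Y).coeff 0 = 1) :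
    ∃ W : PowerSeries ℂ, W.coeff 0 = 1 ∧ W ^ 2 = P ∧
      HahnSeries.single (2 : ℤ) (1 : ℂ) * Y = HahnSeries.ofPowerSeries ℤ ℂ W := by
  set Z : LaurentSeries ℂ := HahnSeries.single (2 : ℤ) (1 : ℂ) * Y with hZ
  have hZ0 : Z ≠ 0 := by
    intro h
    simp [h] at h1
  have hle : Z.order ≤ 0 := HahnSeries.order_le_of_coeff_ne_zero (by simp [h1])
  have hord : Z.order = 0 := by
    by_contra hne
    have hlt : Z.order + Z.order < 0 := by omega
    have h2 := HahnSeries.coeff_mul_order_add_order Z Z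
    rw [← pow_two, hY, PowerSeries.coeff_coe, if_pos hlt] at h2
    have := HahnSeries.leadingCoeff_ne_zero.2 hZ0
    exact mul_ne_zero this this h2.symm
  have hW : HahnSeries.ofPowerSeries ℤ ℂ (LaurentSeries.powerSeriesPart Z) = Z := by
    have h2 := LaurentSeries.single_order_mul_powerSeriesPart Z
    rwa [hord, HahnSeries.single_zero_one, one_mul] at h2
  refine ⟨LaurentSeries.powerSeriesPart Z, ?_, ?_, hW.symm⟩
  · rw [← h1, LaurentSeries.powerSeriesPart_coeff, hord]
    rfl
  · apply HahnSeries.ofPowerSeries_injective (Γ := ℤ)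
    rw [map_pow, hW, hY]

open PowerSeries in
theorem jfraction_step (W : PowerSeries ℂ) (hW0 : W.coeff 0 = 1) (f u v : ℂ)
    (hW : W ^ 2 = (1 + C f * X ^ 2) ^ 2 + C (4 * u) * (X ^ 3 - C v * X ^ 4))
    (d d' w w' c c' : ℂ) (hc : c ≠ 0) (hd : d' = -d - w ^ 2 - f) (hw : d' * (w' + w) = u)
    (hH : d' ^ 2 + f * d' - d' * w * w' = -(u * v)) (hcc : c * c' = -d') :
    (C c⁻¹ * (1 + C w * X) + X ^ 2 * (C (2 * c') * (1 - C w' * X) *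
        (W + 1 + C (f + 2 * d') * X ^ 2)⁻¹)) *
      (C (2 * c) * (1 - C w * X) * (W + 1 + C (f + 2 * d) * X ^ 2)⁻¹) = 1 := by
  have inv : ∀ e : ℂ, (W + 1 + C e * X ^ 2) * (W + 1 + C e * X ^ 2)⁻¹ = 1 := by
    intro e
    apply PowerSeries.mul_inv_cancel
    rw [← coeff_zero_eq_constantCoeff_apply, map_add, map_add, hW0]
    simp
  have hA := inv (f + 2 * d)
  have hA' := inv (f + 2 * d')
  set A := W + 1 + C (f + 2 * d) * X ^ 2 with hAdef
  set A' := W + 1 + C (f + 2 * d') * X ^ 2 with hA'def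
  have hci : (C c : PowerSeries ℂ) * C c⁻¹ = 1 := by
    rw [← map_mul, mul_inv_cancel₀ hc, map_one]
  have e1 := congrArg (C (R := ℂ)) hd
  have e2 := congrArg (C (R := ℂ)) hw
  have e3 := congrArg (C (R := ℂ)) hH
  have e4 := congrArg (C (R := ℂ)) hcc
  simp only [map_add, map_mul, map_sub, map_neg, map_pow, map_ofNat]
    at e1 e2 e3 e4 hW hAdef hA'def ⊢
  have prod : A' * (W - 1 - (C f + 2 * C d') * X ^ 2) =
      4 * C c * C c' * X ^ 2 * (1 - C w * X) * (1 - C w' * X) := by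
    rw [hA'def]
    linear_combination hW - 4 * X ^ 3 * e2 - 4 * X ^ 4 * e3 -
      4 * X ^ 2 * (1 - C w * X) * (1 - C w' * X) * e4
  have lin : 2 * (1 - C w ^ 2 * X ^ 2) + (W - 1 - (C f + 2 * C d') * X ^ 2) = A := by
    rw [hAdef]
    linear_combination (-2 * X ^ 2) * e1
  linear_combination 2 * (1 - C w ^ 2 * X ^ 2) * A⁻¹ * hci - A'⁻¹ * A⁻¹ * prod +
    (W - 1 - (C f + 2 * C d') * X ^ 2) * A⁻¹ * hA' + A⁻¹ * lin + hA

theorem coeff_inv_div (Y : LaurentSeries ℂ) (W : PowerSeries ℂ) (hW0 : W.coeff 0 = 1)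
    (hYW : HahnSeries.single (2 : ℤ) (1 : ℂ) * Y = HahnSeries.ofPowerSeries ℤ ℂ W)
    (f d w c : ℂ) (k : ℕ) :
    (((Y + HahnSeries.single (-2 : ℤ) (1 : ℂ) + HahnSeries.C f + HahnSeries.C (2 * d)) /
        (HahnSeries.C c *
          (HahnSeries.single (-1 : ℤ) (1 : ℂ) - HahnSeries.C w)))⁻¹).coeff ((k : ℤ) + 1) =
      (PowerSeries.C c * (1 - PowerSeries.C w * PowerSeries.X) *
        (W + 1 + PowerSeries.C (f + 2 * d) * PowerSeries.X ^ 2)⁻¹).coeff k := by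
  set A : PowerSeries ℂ := W + 1 + PowerSeries.C (f + 2 * d) * PowerSeries.X ^ 2 with hA
  have hA0 : PowerSeries.constantCoeff A ≠ 0 := by
    rw [← PowerSeries.coeff_zero_eq_constantCoeff_apply, hA, map_add, map_add, hW0]
    simp
  have hAinv := congrArg (HahnSeries.ofPowerSeries ℤ ℂ) (PowerSeries.mul_inv_cancel A hA0)
  rw [map_mul, map_one] at hAinv
  have h2 : (HahnSeries.single (2 : ℤ) (1 : ℂ) : LaurentSeries ℂ) =
      HahnSeries.single (1 : ℤ) (1 : ℂ) ^ 2 := by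
    simp [HahnSeries.single_pow]
  have hm2 : (HahnSeries.single (-2 : ℤ) (1 : ℂ) : LaurentSeries ℂ) =
      HahnSeries.single (-1 : ℤ) (1 : ℂ) ^ 2 := by
    simp [HahnSeries.single_pow]
  have hmul : (HahnSeries.single (1 : ℤ) (1 : ℂ) : LaurentSeries ℂ) *
      HahnSeries.single (-1 : ℤ) (1 : ℂ) = 1 := by
    simp [HahnSeries.single_mul_single]
  set g := PowerSeries.C c * (1 - PowerSeries.C w * PowerSeries.X) * A⁻¹ with hg
  have key : (Y + HahnSeries.single (-2 : ℤ) (1 : ℂ) + HahnSeries.C f + HahnSeries.C (2 * d)) *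
      HahnSeries.single (1 : ℤ) (1 : ℂ) ^ 2 = HahnSeries.ofPowerSeries ℤ ℂ A := by
    rw [hA, map_add, map_add, ← hYW, h2, hm2, map_one (HahnSeries.ofPowerSeries ℤ ℂ),
      map_mul (HahnSeries.ofPowerSeries ℤ ℂ), map_pow,
      HahnSeries.ofPowerSeries_X, HahnSeries.ofPowerSeries_C, map_add]
    linear_combination (HahnSeries.single (1 : ℤ) (1 : ℂ) *
      HahnSeries.single (-1 : ℤ) (1 : ℂ) + 1 : LaurentSeries ℂ) * hmul
  have hne : Y + HahnSeries.single (-2 : ℤ) (1 : ℂ) + HahnSeries.C f + HahnSeries.C (2 * d)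
      ≠ 0 := by
    intro h0
    rw [h0, zero_mul] at key
    rw [← key, zero_mul] at hAinv
    exact zero_ne_one hAinv
  have hinv : ((Y + HahnSeries.single (-2 : ℤ) (1 : ℂ) + HahnSeries.C f +
      HahnSeries.C (2 * d)) / (HahnSeries.C c *
          (HahnSeries.single (-1 : ℤ) (1 : ℂ) - HahnSeries.C w)))⁻¹ =
      HahnSeries.single (1 : ℤ) (1 : ℂ) * HahnSeries.ofPowerSeries ℤ ℂ g := by
    rw [inv_div, div_eq_iff hne, hg, map_mul, map_mul, map_sub,
      map_one (HahnSeries.ofPowerSeries ℤ ℂ), map_mul,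
      HahnSeries.ofPowerSeries_X, HahnSeries.ofPowerSeries_C, HahnSeries.ofPowerSeries_C]
    generalize (HahnSeries.ofPowerSeries ℤ ℂ) A⁻¹ = B at *
    generalize (HahnSeries.ofPowerSeries ℤ ℂ) A = A' at *
    generalize Y + HahnSeries.single (-2 : ℤ) (1 : ℂ) + HahnSeries.C f +
      HahnSeries.C (2 * d) = N at *
    generalize (HahnSeries.single (1 : ℤ) (1 : ℂ) : LaurentSeries ℂ) = T at *
    generalize (HahnSeries.single (-1 : ℤ) (1 : ℂ) : LaurentSeries ℂ) = S at *
    have hT : T ≠ 0 := left_ne_zero_of_mul_eq_one hmul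
    apply mul_left_cancel₀ hT
    rw [← key] at hAinv
    linear_combination HahnSeries.C c * hmul - HahnSeries.C c * (1 - HahnSeries.C w * T) * hAinv
  rw [hinv, HahnSeries.coeff_single_mul, one_mul, add_sub_cancel_right,
    LaurentSeries.coeff_coe_powerSeries]

/-- Section 3.4 of the paper, equations (3.16)–(3.18): the associated tau
sequence of `Y_n`, built from Hankel determinants of the quadratic orthogonal pair
`(Y_n, Ỹ_n)`, is everywhere nonzero and satisfies the single consistent formula
`d_m τ_m² = τ_{m−1} τ_{m+1}` for all integers `m`; in particular `τ_{n+1} = u_n/2` and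
`τ_{n−1} = −u_{n−1}/2`. This resolves Hone's mismatch problem. -/
theorem tau_sequence_consistent
    (f u v : ℂ) (d vv uu : ℤ → ℂ) (Y : LaurentSeries ℂ)
    (hns : ¬ ∃ p : Polynomial ℂ,
      (Polynomial.X ^ 2 + Polynomial.C f) ^ 2 +
        Polynomial.C (4 * u) * (Polynomial.X - Polynomial.C v) = p ^ 2)
    (hY : Y ^ 2 =
      ((HahnSeries.single (-2 : ℤ) (1 : ℂ) : LaurentSeries ℂ) + HahnSeries.C f) ^ 2 +
        HahnSeries.C (4 * u) *
          ((HahnSeries.single (-1 : ℤ) (1 : ℂ) : LaurentSeries ℂ) - HahnSeries.C v))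
    (hYnorm : ((HahnSeries.single (2 : ℤ) (1 : ℂ) : LaurentSeries ℂ) * Y).coeff 0 = 1)
    (hd0 : ∀ n : ℤ, d n ≠ 0)
    (hdrec : ∀ n : ℤ, d (n + 1) = -d n - (vv n) ^ 2 - f)
    (hvrec : ∀ n : ℤ, vv (n + 1) = u / d (n + 1) - vv n)
    (hH : ∀ n : ℤ, (d n) ^ 2 + f * d n + d n * (vv n) ^ 2 - u * vv n = -(u * v))
    (hu0 : ∀ n : ℤ, uu n ≠ 0)
    (hurec : ∀ n : ℤ, uu n * uu (n - 1) = -4 * d n)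
    (Yseq Ytil Ystar aseq : ℤ → LaurentSeries ℂ)
    (hYseq : ∀ n : ℤ, Yseq n =
      (Y + HahnSeries.single (-2 : ℤ) (1 : ℂ) + HahnSeries.C f + HahnSeries.C (2 * d n)) /
        (HahnSeries.C (uu n) *
          (HahnSeries.single (-1 : ℤ) (1 : ℂ) - HahnSeries.C (vv n))))
    (hYtil : ∀ n : ℤ, Ytil n =
      (Y + HahnSeries.single (-2 : ℤ) (1 : ℂ) + HahnSeries.C f + HahnSeries.C (2 * d n)) /
        (HahnSeries.C (uu (n - 1)) *
          (HahnSeries.single (-1 : ℤ) (1 : ℂ) - HahnSeries.C (vv (n - 1)))))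
    (hYstar : ∀ n : ℤ, Ystar n =
      (-Y + HahnSeries.single (-2 : ℤ) (1 : ℂ) + HahnSeries.C f + HahnSeries.C (2 * d n)) /
        (HahnSeries.C (uu n) *
          (HahnSeries.single (-1 : ℤ) (1 : ℂ) - HahnSeries.C (vv n))))
    (haseq : ∀ n : ℤ, aseq n =
      HahnSeries.C (2 / uu n) *
        (HahnSeries.single (-1 : ℤ) (1 : ℂ) + HahnSeries.C (vv n)))
    (n : ℤ) (s st : ℕ → ℂ) (τ : ℤ → ℂ)
    (hs : ∀ k : ℕ, s k = ((Yseq n)⁻¹).coeff ((k : ℤ) + 1))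
    (hst : ∀ k : ℕ, st k = (-(Ytil n)⁻¹).coeff ((k : ℤ) + 1))
    (hτn : τ n = 1)
    (hτpos : ∀ k : ℕ, 1 ≤ k →
      τ (n + k) = Matrix.det (fun i j : Fin k => s (i + j)))
    (hτneg : ∀ k : ℕ, 1 ≤ k →
      τ (n - k) = Matrix.det (fun i j : Fin k => st (i + j)))
    :
    (∀ m : ℤ, τ m ≠ 0) ∧
    (∀ m : ℤ, d m * (τ m) ^ 2 = τ (m - 1) * τ (m + 1)) ∧
    τ (n + 1) = uu n / 2 ∧ τ (n - 1) = -(uu (n - 1)) / 2 := by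
  obtain ⟨W, hW0, hW, hYW⟩ := exists_powerSeries_sqrt Y
    ((1 + PowerSeries.C f * PowerSeries.X ^ 2) ^ 2 +
      PowerSeries.C (4 * u) * (PowerSeries.X ^ 3 - PowerSeries.C v * PowerSeries.X ^ 4))
    (by
      have h2 : (HahnSeries.single (2 : ℤ) (1 : ℂ) : LaurentSeries ℂ) =
          HahnSeries.single (1 : ℤ) (1 : ℂ) ^ 2 := by
        simp [HahnSeries.single_pow]
      have hm2 : (HahnSeries.single (-2 : ℤ) (1 : ℂ) : LaurentSeries ℂ) =
          HahnSeries.single (-1 : ℤ) (1 : ℂ) ^ 2 := by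
        simp [HahnSeries.single_pow]
      have hmul : (HahnSeries.single (1 : ℤ) (1 : ℂ) : LaurentSeries ℂ) *
          HahnSeries.single (-1 : ℤ) (1 : ℂ) = 1 := by
        simp [HahnSeries.single_mul_single]
      rw [mul_pow, hY, h2, hm2]
      simp only [map_add, map_mul, map_sub, map_pow, map_one, HahnSeries.ofPowerSeries_X,
        HahnSeries.ofPowerSeries_C]
      generalize (HahnSeries.single (1 : ℤ) (1 : ℂ) : LaurentSeries ℂ) = T at *
      generalize (HahnSeries.single (-1 : ℤ) (1 : ℂ) : LaurentSeries ℂ) = S at *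
      linear_combination ((T ^ 2 * S ^ 2 + 2 * HahnSeries.C f * T ^ 2 + 1) * (T * S + 1) +
        HahnSeries.C 4 * HahnSeries.C u * T ^ 3) * hmul) hYnorm
  have hvd : ∀ m : ℤ, d (m + 1) * (vv (m + 1) + vv m) = u := by
    intro m
    rw [hvrec m, sub_add_cancel, mul_div_cancel₀ _ (hd0 _)]
  have hprod : ∀ m : ℤ, d (m + 1) ^ 2 + f * d (m + 1) - d (m + 1) * vv m * vv (m + 1) =
      -(u * v) := by
    intro m
    linear_combination hH (m + 1) - vv (m + 1) * hvd m
  have huu : ∀ m : ℤ, uu (m + 1) * uu m = -4 * d (m + 1) := by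
    intro m
    simpa using hurec (m + 1)
  -- the power series of `(Yseq m)⁻¹` and of `-(Ytil m)⁻¹`, up to the factor `t`
  let G : ℂ → ℂ → ℂ → PowerSeries ℂ := fun c w e =>
    PowerSeries.C (2 * c) * (1 - PowerSeries.C w * PowerSeries.X) *
      (W + 1 + PowerSeries.C (f + 2 * e) * PowerSeries.X ^ 2)⁻¹
  have hpos := hankelDet_jfraction
    (fun k : ℕ => G (uu (n + k) / 2) (vv (n + k)) (d (n + k)))
    (fun k => uu (n + k) / 2) (fun k => vv (n + k))
    (fun k => div_ne_zero (hu0 _) two_ne_zero)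
    (by
      intro m
      have e : n + ((m + 1 : ℕ) : ℤ) = n + m + 1 := by omega
      simp only [e]
      exact jfraction_step W hW0 f u v hW _ _ _ _ _ _ (div_ne_zero (hu0 _) two_ne_zero)
        (hdrec _) (hvd _) (hprod _) (by linear_combination huu (n + m) / 4))
  have hneg := hankelDet_jfraction
    (fun k : ℕ => G (-uu (n - k - 1) / 2) (vv (n - k - 1)) (d (n - k)))
    (fun k => -uu (n - k - 1) / 2) (fun k => vv (n - k - 1))
    (fun k => div_ne_zero (neg_ne_zero.2 (hu0 _)) two_ne_zero)
    (by
      intro m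
      have e : n - ((m + 1 : ℕ) : ℤ) = n - m - 1 := by omega
      have h1 := hdrec (n - m - 1)
      have h2 := hvd (n - m - 1 - 1)
      have h3 := hprod (n - m - 1 - 1)
      have h4 := huu (n - m - 1 - 1)
      rw [sub_add_cancel] at h1 h2 h3 h4
      simp only [e]
      exact jfraction_step W hW0 f u v hW _ _ _ _ _ _
        (div_ne_zero (neg_ne_zero.2 (hu0 _)) two_ne_zero)
        (by linear_combination h1) (by linear_combination h2) (by linear_combination h3)
        (by linear_combination h4 / 4))
  have hτp : ∀ k : ℕ, τ (n + k) =
      hankelDet (fun i => (G (uu n / 2) (vv n) (d n)).coeff i) k := by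
    intro k
    rcases Nat.eq_zero_or_pos k with rfl | hk
    · simp [hankelDet_zero, hτn]
    · have hsG : s = fun i => (G (uu n / 2) (vv n) (d n)).coeff i := by
        funext i
        rw [hs, hYseq, coeff_inv_div Y W hW0 hYW]
        simp only [G, mul_div_cancel₀ (uu n) (two_ne_zero (α := ℂ))]
      rw [hτpos k hk, hsG]
      rfl
  have hτm : ∀ k : ℕ, τ (n - k) =
      hankelDet (fun i => (G (-uu (n - 1) / 2) (vv (n - 1)) (d n)).coeff i) k := by
    intro k
    rcases Nat.eq_zero_or_pos k with rfl | hk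
    · simp [hankelDet_zero, hτn]
    · have hsG : st = fun i => (G (-uu (n - 1) / 2) (vv (n - 1)) (d n)).coeff i := by
        funext i
        rw [hst, hYtil, HahnSeries.coeff_neg, coeff_inv_div Y W hW0 hYW]
        simp only [G, mul_div_cancel₀ (-uu (n - 1)) (two_ne_zero (α := ℂ)), map_neg, neg_mul]
      rw [hτneg k hk, hsG]
      rfl
  have hG0 : ∀ c w e : ℂ, (G c w e).coeff 0 = c := by
    intro c w e
    simp only [G, PowerSeries.coeff_zero_eq_constantCoeff_apply, map_mul, map_sub, map_add,
      map_pow, map_one, PowerSeries.constantCoeff_inv, PowerSeries.constantCoeff_C,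
      PowerSeries.constantCoeff_X] at hW0 ⊢
    rw [hW0]
    norm_num
    ring
  have hτ1 : τ (n + 1) = uu n / 2 := by
    have := hτp 1
    rwa [hankelDet_one, hG0] at this
  have hτm1 : τ (n - 1) = -(uu (n - 1)) / 2 := by
    have := hτm 1
    rwa [hankelDet_one, hG0] at this
  refine ⟨fun m => ?_, fun m => ?_, hτ1, hτm1⟩
  · rcases le_total n m with h | h
    · obtain ⟨k, rfl⟩ := Int.le.dest h
      rw [hτp]
      simpa using (hpos k 0).1
    · obtain ⟨k, hk⟩ := Int.le.dest h
      obtain rfl : m = n - k := by omega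
      rw [hτm]
      simpa using (hneg k 0).1
  · rcases lt_trichotomy n m with h | rfl | h
    · obtain ⟨k, rfl⟩ : ∃ k : ℕ, m = n + (k + 1 : ℕ) := ⟨(m - n - 1).toNat, by omega⟩
      have h1 := (hpos k 0).2
      simp only [Nat.zero_add, Nat.cast_zero, add_zero, ← hτp] at h1
      have h2 := huu (n + k)
      rw [show n + ((k + 1 : ℕ) : ℤ) - 1 = n + k by omega,
        show n + ((k + 1 : ℕ) : ℤ) + 1 = n + (k + 2 : ℕ) by omega, ← h1,
        show n + ((k + 1 : ℕ) : ℤ) = n + k + 1 by omega]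
      linear_combination τ (n + k + 1) ^ 2 * h2 / 4
    · rw [hτ1, hτm1, hτn]
      linear_combination hurec n / 4
    · obtain ⟨k, rfl⟩ : ∃ k : ℕ, m = n - (k + 1 : ℕ) := ⟨(n - m - 1).toNat, by omega⟩
      have h1 := (hneg k 0).2
      simp only [Nat.zero_add, Nat.cast_zero, sub_zero, ← hτm] at h1
      have h2 := hurec (n - k - 1)
      rw [show n - ((k + 1 : ℕ) : ℤ) - 1 = n - (k + 2 : ℕ) by omega,
        show n - ((k + 1 : ℕ) : ℤ) + 1 = n - k by omega, mul_comm (τ _) (τ _), ← h1,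
        show n - ((k + 1 : ℕ) : ℤ) = n - k - 1 by omega]
      linear_combination τ (n - k - 1) ^ 2 * h2 / 4
end

section
/- Let f, u, v ∈ ℂ and let d_n, v_n ∈ ℂ (n ∈ ℤ) satisfy, for every n: d_n ≠ 0, d_{n+1} = −d_n − v_n² − f, v_{n+1} = u/d_{n+1} − v_n, and d_n² + f·d_n + d_n·v_n² − u·v_n = −u·v. Then for every n ∈ ℤ: d_{n−1}·d_n²·d_{n+1} = α·d_n + β, where α := u² and β := u²·(v² + f). -/
/-- Lemma 4.1 of the paper: along the orbit of the map `Φ` with conserved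
quantity `H = −uv`, the sequence `d_n` satisfies
`d_{n−1} d_n² d_{n+1} = α d_n + β` with `α = u²` and `β = u²(v²+f)`. -/
theorem d_recurrence
    (f u v : ℂ) (d vv : ℤ → ℂ)
    (hd0 : ∀ n : ℤ, d n ≠ 0)
    (hdrec : ∀ n : ℤ, d (n + 1) = -d n - (vv n) ^ 2 - f)
    (hvrec : ∀ n : ℤ, vv (n + 1) = u / d (n + 1) - vv n)
    (hH : ∀ n : ℤ, (d n) ^ 2 + f * d n + d n * (vv n) ^ 2 - u * vv n = -(u * v)) :
    ∀ n : ℤ, d (n - 1) * (d n) ^ 2 * d (n + 1) = u ^ 2 * d n + u ^ 2 * (v ^ 2 + f) := by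
  have hprod : ∀ n : ℤ, d n * d (n + 1) = u * (v - vv n) := fun n => by
    linear_combination d n * hdrec n - hH n
  intro n
  have hprev : d (n - 1) * d n = u * (v - vv (n - 1)) := by
    simpa using hprod (n - 1)
  have hv : vv n + vv (n - 1) = u / d n := by
    have h := hvrec (n - 1)
    rw [sub_add_cancel] at h
    linear_combination h
  have hquot : u / d n * (vv n - v) = d n + f + vv n ^ 2 := by
    rw [div_mul_eq_mul_div, div_eq_iff (hd0 n)]
    linear_combination -hH n
  calc d (n - 1) * d n ^ 2 * d (n + 1)
      = (d (n - 1) * d n) * (d n * d (n + 1)) := by ring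
    _ = u * (v - vv (n - 1)) * (u * (v - vv n)) := by rw [hprev, hprod]
    _ = u ^ 2 * d n + u ^ 2 * (v ^ 2 + f) := by
      linear_combination u ^ 2 * hquot + u ^ 2 * (vv n - v) * hv
end

section
/- Suppose τ⁽ⁿ⁾ is the associated tau sequence at level n and τ⁽ⁿ⁻¹⁾ is the associated tau sequence at level n−1. Then τ⁽ⁿ⁾_n = 1, and for every integer k ≠ n: τ⁽ⁿ⁾_k = (−1)^{k−n} · (u_{n−1}/2)^{2n−2k−1} · τ⁽ⁿ⁻¹⁾_k (an integer power, possibly negative, of the nonzero number u_{n−1}/2). Hence all the tau sequences in the family are identical up to gauge transformations. -/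
/-- Two solutions of `x_{m-1} x_{m+1} = d_m x_m ^ 2`, one nowhere vanishing, which agree at two
consecutive indices are equal. -/
theorem eq_of_bilinear_recurrence {K : Type*} [Field K] {d f g : ℤ → K}
    (hf : ∀ m, f m ≠ 0)
    (hfrec : ∀ m, f (m - 1) * f (m + 1) = d m * f m ^ 2)
    (hgrec : ∀ m, g (m - 1) * g (m + 1) = d m * g m ^ 2)
    {n : ℤ} (hn : f n = g n) (hn' : f (n - 1) = g (n - 1)) (k : ℤ) : f k = g k := by
  suffices h : f k = g k ∧ f (k - 1) = g (k - 1) from h.1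
  induction k using Int.inductionOn' (b := n) with
  | zero => exact ⟨hn, hn'⟩
  | succ k _ ih =>
    obtain ⟨h₀, h₁⟩ := ih
    rw [add_sub_cancel_right]
    refine ⟨mul_left_cancel₀ (hf (k - 1)) ?_, h₀⟩
    rw [hfrec, h₁, hgrec, h₀]
  | pred k _ ih =>
    obtain ⟨h₀, h₁⟩ := ih
    refine ⟨h₁, mul_right_cancel₀ (hf k) ?_⟩
    have hf' := hfrec (k - 1)
    have hg' := hgrec (k - 1)
    rw [sub_add_cancel] at hf' hg'
    rw [hf', h₀, hg', h₁]

/-- The geometric gauge factor `c ^ (k - n) * a ^ (2 * n - 2 * k - 1)` satisfies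
`γ_{m-1} γ_{m+1} = γ_m ^ 2`. -/
theorem gauge_factor_mul {K : Type*} [Field K] {a c : K} (ha : a ≠ 0) (hc : c ≠ 0) (n m : ℤ) :
    (c ^ (m - 1 - n) * a ^ (2 * n - 2 * (m - 1) - 1)) *
      (c ^ (m + 1 - n) * a ^ (2 * n - 2 * (m + 1) - 1)) =
      (c ^ (m - n) * a ^ (2 * n - 2 * m - 1)) ^ 2 := by
  rw [mul_mul_mul_comm, ← zpow_add₀ hc, ← zpow_add₀ ha, sq, mul_mul_mul_comm,
    ← zpow_add₀ hc, ← zpow_add₀ ha]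
  congr 2 <;> ring

/-- Theorem 4.3 of the paper: the associated tau sequences at levels `n`
and `n−1` agree up to a gauge transformation: `τ⁽ⁿ⁾_n = 1` and, for every `k ≠ n`,
`τ⁽ⁿ⁾_k = (−1)^{k−n} (u_{n−1}/2)^{2n−2k−1} τ⁽ⁿ⁻¹⁾_k`. -/
theorem tau_gauge_relation
    (uu : ℤ → ℂ) (hu : ∀ m : ℤ, uu m ≠ 0) (n : ℤ)
    (σ σ' : ℤ → ℂ)
    (hσnz : ∀ m : ℤ, σ m ≠ 0)
    (hσn : σ n = 1) (hσp : σ (n + 1) = uu n / 2) (hσm : σ (n - 1) = -(uu (n - 1)) / 2)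
    (hσrec : ∀ m : ℤ, σ (m - 1) * σ (m + 1) = (-(uu m * uu (m - 1)) / 4) * (σ m) ^ 2)
    (hσ'nz : ∀ m : ℤ, σ' m ≠ 0)
    (hσ'n : σ' (n - 1) = 1) (hσ'p : σ' n = uu (n - 1) / 2)
    (hσ'm : σ' (n - 2) = -(uu (n - 2)) / 2)
    (hσ'rec : ∀ m : ℤ, σ' (m - 1) * σ' (m + 1) = (-(uu m * uu (m - 1)) / 4) * (σ' m) ^ 2) :
    σ n = 1 ∧
    ∀ k : ℤ, k ≠ n →
      σ k = (-1 : ℂ) ^ (k - n) * (uu (n - 1) / 2) ^ (2 * n - 2 * k - 1) * σ' k := by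
  have ha : uu (n - 1) / 2 ≠ 0 := div_ne_zero (hu _) two_ne_zero
  refine ⟨hσn, fun k _ => eq_of_bilinear_recurrence (n := n)
    (g := fun k => (-1 : ℂ) ^ (k - n) * (uu (n - 1) / 2) ^ (2 * n - 2 * k - 1) * σ' k)
    hσnz hσrec (fun m => ?_) ?_ ?_ k⟩
  · rw [mul_mul_mul_comm, gauge_factor_mul ha (neg_ne_zero.mpr one_ne_zero), hσ'rec]
    ring
  · have he : 2 * n - 2 * n - 1 = -1 := by ring
    rw [hσn, hσ'p, sub_self, zpow_zero, he, zpow_neg_one, one_mul, inv_mul_cancel₀ ha]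
  · have he : 2 * n - 2 * (n - 1) - 1 = 1 := by ring
    have he' : n - 1 - n = -1 := by ring
    rw [hσm, hσ'n, he, he', zpow_neg_one, zpow_one, inv_neg_one]
    ring
end

section
/- Suppose τ⁽ⁿ⁾ is the associated tau sequence at level n. Then every term is an explicit monomial in the u_m: for all k ∈ ℤ, τ⁽ⁿ⁾_k = ∏_{m=k}^{n−1} (−1)^{k−m+1}·(u_m/2)^{2m−2k+1} if n > k; τ⁽ⁿ⁾_k = 1 if n = k; and τ⁽ⁿ⁾_k = ∏_{m=n}^{k−1} (−1)^{k−m+1}·(u_m/2)^{2k−2m−1} if n < k. -/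
section SecondOrderRecurrence

variable {K : Type*} [Field K] {v t : ℕ → K}

/-- The first-order form of the recurrence `t a * t (a + 2) = -(v (a + 1) * v a) * t (a + 1) ^ 2`. -/
theorem succ_eq_mul_prod_of_recurrence (ht : ∀ a, t a ≠ 0) (h0 : t 0 = 1) (h1 : t 1 = v 0)
    (hrec : ∀ a, t a * t (a + 2) = -(v (a + 1) * v a) * t (a + 1) ^ 2) (a : ℕ) :
    t (a + 1) = t a * v a * ∏ i ∈ Finset.range a, -(v i ^ 2) := by
  induction a with
  | zero => simp [h0, h1]
  | succ a ih =>
    apply mul_left_cancel₀ (ht a)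
    rw [hrec, Finset.prod_range_succ]
    linear_combination (-(v (a + 1) * v a) * t (a + 1)) * ih

theorem eq_prod_zpow_of_recurrence (hv : ∀ a, v a ≠ 0) (ht : ∀ a, t a ≠ 0) (h0 : t 0 = 1)
    (h1 : t 1 = v 0) (hrec : ∀ a, t a * t (a + 2) = -(v (a + 1) * v a) * t (a + 1) ^ 2) (a : ℕ) :
    t a = ∏ i ∈ Finset.range a,
      (-1 : K) ^ ((a : ℤ) - i + 1) * v i ^ (2 * (a : ℤ) - 2 * i - 1) := by
  induction a with
  | zero => simpa using h0
  | succ a ih =>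
    rw [succ_eq_mul_prod_of_recurrence ht h0 h1 hrec, ih, Finset.prod_range_succ, mul_right_comm,
      ← Finset.prod_mul_distrib]
    congr 1
    · refine Finset.prod_congr rfl fun i _ => ?_
      have hsign : ((a + 1 : ℕ) : ℤ) - i + 1 = ((a : ℤ) - i + 1) + 1 := by push_cast; ring
      have hexp : 2 * ((a + 1 : ℕ) : ℤ) - 2 * i - 1 = (2 * (a : ℤ) - 2 * i - 1) + 2 := by
        push_cast; ring
      rw [hsign, hexp, zpow_add_one₀ (by simp) ((a : ℤ) - i + 1), zpow_add₀ (hv i), zpow_ofNat]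
      ring
    · have hsign : ((a + 1 : ℕ) : ℤ) - a + 1 = 2 := by push_cast; ring
      have hexp : 2 * ((a + 1 : ℕ) : ℤ) - 2 * a - 1 = 1 := by push_cast; ring
      rw [hsign, hexp]
      simp

end SecondOrderRecurrence

/-- Corollary 4.4 of the paper: every term of the associated tau sequence at
level `n` is an explicit monomial in the `u_m`. -/
theorem tau_monomial_formula
    (uu : ℤ → ℂ) (hu : ∀ m : ℤ, uu m ≠ 0) (n : ℤ)
    (τ : ℤ → ℂ)
    (hτnz : ∀ m : ℤ, τ m ≠ 0)
    (hτn : τ n = 1) (hτp : τ (n + 1) = uu n / 2) (hτm : τ (n - 1) = -(uu (n - 1)) / 2)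
    (hτrec : ∀ m : ℤ, τ (m - 1) * τ (m + 1) = (-(uu m * uu (m - 1)) / 4) * (τ m) ^ 2) :
    ∀ k : ℤ,
      (n > k → τ k = ∏ i ∈ Finset.range (n - k).toNat,
        ((-1 : ℂ) ^ (k - (k + (i : ℤ)) + 1) *
          (uu (k + (i : ℤ)) / 2) ^ (2 * (k + (i : ℤ)) - 2 * k + 1))) ∧
      (n = k → τ k = 1) ∧
      (n < k → τ k = ∏ i ∈ Finset.range (k - n).toNat,
        ((-1 : ℂ) ^ (k - (n + (i : ℤ)) + 1) *
          (uu (n + (i : ℤ)) / 2) ^ (2 * k - 2 * (n + (i : ℤ)) - 1))) := by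
  intro k
  refine ⟨fun hk => ?_, fun hk => hk ▸ hτn, fun hk => ?_⟩
  · obtain ⟨a, rfl⟩ : ∃ a : ℕ, k = n - a := ⟨(n - k).toNat, by lia⟩
    have hform := eq_prod_zpow_of_recurrence (v := fun j : ℕ => -(uu (n - 1 - j) / 2))
      (t := fun j : ℕ => τ (n - j)) (by simp [hu]) (fun j => hτnz _) (by simpa using hτn)
      (by simpa [neg_div] using hτm) (fun j => by
        have h := hτrec (n - (j + 1))
        rw [show n - ((j : ℤ) + 1) - 1 = n - (j + 2) by ring,
          show n - ((j : ℤ) + 1) + 1 = n - j by ring] at h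
        push_cast
        rw [show n - 1 - ((j : ℤ) + 1) = n - (j + 2) by ring,
          show n - 1 - (j : ℤ) = n - (j + 1) by ring]
        linear_combination h) a
    rw [hform, show (n - (n - (a : ℤ))).toNat = a by lia, ← Finset.prod_range_reflect]
    refine Finset.prod_congr rfl fun i hi => ?_
    have hia : ((a - 1 - i : ℕ) : ℤ) = a - 1 - i := by
      have := Finset.mem_range.mp hi
      lia
    have hodd : Odd (2 * (i : ℤ) + 1) := odd_two_mul_add_one _
    rw [hia, show n - 1 - ((a : ℤ) - 1 - i) = n - a + i by ring,
      show 2 * (a : ℤ) - 2 * (a - 1 - i) - 1 = 2 * i + 1 by ring,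
      show 2 * (n - (a : ℤ) + i) - 2 * (n - a) + 1 = 2 * i + 1 by ring,
      show (a : ℤ) - (a - 1 - i) + 1 = (n - a - (n - a + i) + 1) + (2 * i + 1) by ring,
      zpow_add₀ (by simp), hodd.neg_one_zpow, hodd.neg_zpow]
    ring
  · obtain ⟨a, rfl⟩ : ∃ a : ℕ, k = n + a := ⟨(k - n).toNat, by lia⟩
    have hform := eq_prod_zpow_of_recurrence (v := fun j : ℕ => uu (n + j) / 2)
      (t := fun j : ℕ => τ (n + j)) (by simp [hu]) (fun j => hτnz _) (by simpa using hτn)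
      (by simpa using hτp) (fun j => by
        have h := hτrec (n + (j + 1))
        rw [show n + ((j : ℤ) + 1) - 1 = n + j by ring,
          show n + ((j : ℤ) + 1) + 1 = n + (j + 2) by ring] at h
        push_cast
        linear_combination h) a
    rw [hform, show (n + (a : ℤ) - n).toNat = a by lia]
    refine Finset.prod_congr rfl fun i _ => ?_
    rw [show n + (a : ℤ) - (n + i) + 1 = a - i + 1 by ring,
      show 2 * (n + (a : ℤ)) - 2 * (n + i) - 1 = 2 * a - 2 * i - 1 by ring]
end

section
/- Let F = ℚ(a, b, x, y, z) be the field of rational functions in five indeterminates over ℚ. There exists a unique sequence τ : ℤ → F such that τ_n ≠ 0 for all n ∈ ℤ, τ₋₁ = x, τ₀ = 1, τ₁ = y, τ₂ = z, and τ_{n+2}·τ_{n−2} = a·τ_{n+1}·τ_{n−1} + b·τ_n² for all n ∈ ℤ. Moreover, every term τ_n lies in the subring ℤ[a, b, x, x⁻¹, y, y⁻¹, z, z⁻¹] of Laurent polynomials; i.e., the bilateral Somos-4 recurrence exhibits the Laurent phenomenon. -/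
/-- `t` satisfies the Somos-4 recurrence on `ℕ` and has no zero terms. -/
def IsSomosFour {F : Type*} [Field F] (a b : F) (t : ℕ → F) : Prop :=
  (∀ n, t n ≠ 0) ∧
    ∀ n, t (n + 4) * t n = a * t (n + 3) * t (n + 1) + b * t (n + 2) ^ 2

/-- `τ` satisfies the Somos-4 recurrence on `ℤ` and has no zero terms. -/
def IsBilateralSomosFour {F : Type*} [Field F] (a b : F) (τ : ℤ → F) : Prop :=
  (∀ n, τ n ≠ 0) ∧
    ∀ n : ℤ, τ (n + 2) * τ (n - 2) = a * τ (n + 1) * τ (n - 1) + b * (τ n) ^ 2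

namespace IsBilateralSomosFour

variable {F : Type*} [Field F] {a b : F} {τ : ℤ → F}

theorem shift (h : IsBilateralSomosFour a b τ) (k : ℤ) :
    IsSomosFour a b (fun n : ℕ => τ (k + n)) := by
  refine ⟨fun n => h.1 _, fun n => ?_⟩
  have := h.2 (k + n + 2)
  push_cast
  rw [show k + ((n : ℤ) + 4) = k + n + 2 + 2 by ring, show k + (n : ℤ) = k + n + 2 - 2 by ring,
    show k + ((n : ℤ) + 3) = k + n + 2 + 1 by ring, show k + ((n : ℤ) + 1) = k + n + 2 - 1 by ring,
    show k + ((n : ℤ) + 2) = k + n + 2 by ring]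
  simpa using this

theorem reflect (h : IsBilateralSomosFour a b τ) :
    IsBilateralSomosFour a b (fun n => τ (-n)) := by
  refine ⟨fun n => h.1 _, fun n => ?_⟩
  have := h.2 (-n)
  beta_reduce
  rw [show -(n + 2) = -n - 2 by ring, show -(n - 2) = -n + 2 by ring,
    show -(n + 1) = -n - 1 by ring, show -(n - 1) = -n + 1 by ring]
  linear_combination this

end IsBilateralSomosFour

namespace IsSomosFour

theorem eq_of_initial {F : Type*} [Field F] {a b : F} {t t' : ℕ → F}
    (h : IsSomosFour a b t) (h' : IsSomosFour a b t')
    (e0 : t 0 = t' 0) (e1 : t 1 = t' 1) (e2 : t 2 = t' 2) (e3 : t 3 = t' 3) (n : ℕ) :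
    t n = t' n := by
  induction n using Nat.strong_induction_on with
  | _ n ih =>
    match n with
    | 0 => exact e0
    | 1 => exact e1
    | 2 => exact e2
    | 3 => exact e3
    | n + 4 =>
      refine mul_right_cancel₀ (h.1 n) ?_
      have := h'.2 n
      rw [← ih n (by lia), ← ih (n + 1) (by lia), ← ih (n + 2) (by lia),
        ← ih (n + 3) (by lia)] at this
      rw [h.2 n, this]

end IsSomosFour

section Existence

variable {F : Type*} [Field F]

/-- The Somos-4 shift `(e, p, q, r) ↦ (p, q, r, (a p r + b q²) / e)`, as a permutation of the
quadruples of elements satisfying a predicate which is closed under the operations used and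
excludes zero. -/
def somosFourShift {Pos : F → Prop} (h0 : ∀ f, Pos f → f ≠ 0)
    (hadd : ∀ f g, Pos f → Pos g → Pos (f + g)) (hmul : ∀ f g, Pos f → Pos g → Pos (f * g))
    (hdiv : ∀ f g, Pos f → Pos g → Pos (f / g)) {a b : F} (ha : Pos a) (hb : Pos b) :
    Equiv.Perm ({f // Pos f} × {f // Pos f} × {f // Pos f} × {f // Pos f}) where
  toFun v := (v.2.1, v.2.2.1, v.2.2.2, ⟨(a * v.2.2.2 * v.2.1 + b * (v.2.2.1 * v.2.2.1)) / v.1,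
    hdiv _ _ (hadd _ _ (hmul _ _ (hmul _ _ ha v.2.2.2.2) v.2.1.2)
      (hmul _ _ hb (hmul _ _ v.2.2.1.2 v.2.2.1.2))) v.1.2⟩)
  invFun v := (⟨(a * v.2.2.1 * v.1 + b * (v.2.1 * v.2.1)) / v.2.2.2,
    hdiv _ _ (hadd _ _ (hmul _ _ (hmul _ _ ha v.2.2.1.2) v.1.2)
      (hmul _ _ hb (hmul _ _ v.2.1.2 v.2.1.2))) v.2.2.2.2⟩, v.1, v.2.1, v.2.2.1)
  left_inv := by
    rintro ⟨⟨e, he⟩, ⟨p, hp⟩, ⟨q, hq⟩, ⟨r, hr⟩⟩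
    have hne := h0 _ (hadd _ _ (hmul _ _ (hmul _ _ ha hr) hp) (hmul _ _ hb (hmul _ _ hq hq)))
    simp only [Prod.mk.injEq, Subtype.mk.injEq, and_true]
    exact div_div_cancel₀ hne
  right_inv := by
    rintro ⟨⟨e, he⟩, ⟨p, hp⟩, ⟨q, hq⟩, ⟨r, hr⟩⟩
    have hne := h0 _ (hadd _ _ (hmul _ _ (hmul _ _ ha hq) he) (hmul _ _ hb (hmul _ _ hp hp)))
    simp only [Prod.mk.injEq, Subtype.mk.injEq, true_and]
    exact div_div_cancel₀ hne

theorem exists_isBilateralSomosFour {Pos : F → Prop} (h0 : ∀ f, Pos f → f ≠ 0)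
    (hadd : ∀ f g, Pos f → Pos g → Pos (f + g)) (hmul : ∀ f g, Pos f → Pos g → Pos (f * g))
    (hdiv : ∀ f g, Pos f → Pos g → Pos (f / g)) {a b : F} (ha : Pos a) (hb : Pos b)
    {t₀ t₁ t₂ t₃ : F} (ht₀ : Pos t₀) (ht₁ : Pos t₁) (ht₂ : Pos t₂) (ht₃ : Pos t₃) :
    ∃ τ : ℤ → F, IsBilateralSomosFour a b τ ∧
      τ (-1) = t₀ ∧ τ 0 = t₁ ∧ τ 1 = t₂ ∧ τ 2 = t₃ := by
  set Φ := somosFourShift h0 hadd hmul hdiv ha hb with hΦ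
  set v : ℤ → {f // Pos f} × {f // Pos f} × {f // Pos f} × {f // Pos f} :=
    fun n => (Φ ^ (n + 1)) (⟨t₀, ht₀⟩, ⟨t₁, ht₁⟩, ⟨t₂, ht₂⟩, ⟨t₃, ht₃⟩) with hv
  have hstep (n : ℤ) : v (n + 1) = Φ (v n) := by
    simp only [hv]
    rw [add_comm (n + 1) 1, zpow_one_add, Equiv.Perm.mul_apply]
  have h1 (n : ℤ) : (v (n + 1)).1 = (v n).2.1 := by rw [hstep]; rfl
  have h2 (n : ℤ) : (v (n + 2)).1 = (v n).2.2.1 := by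
    rw [show n + 2 = n + 1 + 1 by ring, h1, hstep]; rfl
  have h3 (n : ℤ) : (v (n + 3)).1 = (v n).2.2.2 := by
    rw [show n + 3 = n + 1 + 2 by ring, h2, hstep]; rfl
  have h4 (n : ℤ) : ((v (n + 4)).1 : F) * (v n).1 =
      a * (v (n + 3)).1 * (v (n + 1)).1 + b * ((v (n + 2)).1 : F) ^ 2 := by
    have : ((v (n + 4)).1 : F) =
        (a * (v n).2.2.2 * (v n).2.1 + b * ((v n).2.2.1 * (v n).2.2.1)) / (v n).1 := by
      rw [show n + 4 = n + 1 + 3 by ring, h3, hstep]; rfl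
    rw [this, h1, h2, h3, div_mul_cancel₀ _ (h0 _ (v n).1.2), sq]
  have hinit : v (-1) = (⟨t₀, ht₀⟩, ⟨t₁, ht₁⟩, ⟨t₂, ht₂⟩, ⟨t₃, ht₃⟩) := by simp [hv]
  refine ⟨fun n => (v n).1, ⟨fun n => h0 _ (v n).1.2, fun n => ?_⟩, ?_, ?_, ?_, ?_⟩
  · have := h4 (n - 2)
    rwa [show n - 2 + 4 = n + 2 by ring, show n - 2 + 3 = n + 1 by ring,
      show n - 2 + 1 = n - 1 by ring, show n - 2 + 2 = n by ring] at this
  · simp [hinit]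
  · simpa [hinit] using congrArg Subtype.val (h1 (-1))
  · simpa [hinit] using congrArg Subtype.val (h2 (-1))
  · simpa [hinit] using congrArg Subtype.val (h3 (-1))

/-- Rational functions which are quotients of polynomials with positive value at `(1, …, 1)`. -/
def IsPosAtOne {σ : Type*} [Algebra (MvPolynomial σ ℚ) F] (f : F) : Prop :=
  ∃ p q : MvPolynomial σ ℚ, 0 < MvPolynomial.eval 1 p ∧ 0 < MvPolynomial.eval 1 q ∧
    f = algebraMap (MvPolynomial σ ℚ) F p / algebraMap (MvPolynomial σ ℚ) F q

namespace IsPosAtOne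

variable {σ : Type*} [Algebra (MvPolynomial σ ℚ) F]

theorem algebraMap_X (i : σ) :
    IsPosAtOne (σ := σ) (algebraMap (MvPolynomial σ ℚ) F (MvPolynomial.X i)) :=
  ⟨MvPolynomial.X i, 1, by simp, by simp, by simp⟩

theorem one : IsPosAtOne (σ := σ) (1 : F) := ⟨1, 1, by simp, by simp, by simp⟩

theorem mul {f g : F} (hf : IsPosAtOne (σ := σ) f) (hg : IsPosAtOne (σ := σ) g) :
    IsPosAtOne (σ := σ) (f * g) := by
  obtain ⟨p, q, hp, hq, rfl⟩ := hf
  obtain ⟨r, s, hr, hs, rfl⟩ := hg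
  exact ⟨p * r, q * s, by simpa using mul_pos hp hr, by simpa using mul_pos hq hs, by
    simp only [map_mul]; exact div_mul_div_comm _ _ _ _⟩

theorem div {f g : F} (hf : IsPosAtOne (σ := σ) f) (hg : IsPosAtOne (σ := σ) g) :
    IsPosAtOne (σ := σ) (f / g) := by
  obtain ⟨r, s, hr, hs, rfl⟩ := hg
  rw [div_eq_mul_inv, inv_div]
  exact hf.mul ⟨s, r, hs, hr, rfl⟩

variable [FaithfulSMul (MvPolynomial σ ℚ) F]

theorem algebraMap_ne_zero {p : MvPolynomial σ ℚ} (hp : 0 < MvPolynomial.eval 1 p) :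
    algebraMap (MvPolynomial σ ℚ) F p ≠ 0 := by
  rw [Ne, FaithfulSMul.algebraMap_eq_zero_iff]
  rintro rfl
  simp at hp

theorem ne_zero {f : F} (hf : IsPosAtOne (σ := σ) f) : f ≠ 0 := by
  obtain ⟨p, q, hp, hq, rfl⟩ := hf
  exact div_ne_zero (algebraMap_ne_zero hp) (algebraMap_ne_zero hq)

theorem add {f g : F} (hf : IsPosAtOne (σ := σ) f) (hg : IsPosAtOne (σ := σ) g) :
    IsPosAtOne (σ := σ) (f + g) := by
  obtain ⟨p, q, hp, hq, rfl⟩ := hf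
  obtain ⟨r, s, hr, hs, rfl⟩ := hg
  refine ⟨p * s + q * r, q * s, ?_, by simpa using mul_pos hq hs, ?_⟩
  · simpa using add_pos (mul_pos hp hs) (mul_pos hq hr)
  · simp only [map_mul, map_add]
    exact div_add_div _ _ (algebraMap_ne_zero hq) (algebraMap_ne_zero hs)

end IsPosAtOne

end Existence

section Local

theorem somosFour_dvd {A : Type*} [CommRing A] {a b e p q r s p' q' r' : A}
    (hp : IsUnit p) (hq : IsUnit q) (hr : IsUnit r) (h : s * e = a * r * p + b * q ^ 2)
    (hp' : p' * p = a * s * q + b * r ^ 2) (hq' : q' * q = a * p' * r + b * s ^ 2)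
    (hr' : r' * r = a * q' * s + b * p' ^ 2) :
    s ∣ a * r' * p' + b * q' ^ 2 := by
  have hu : IsUnit (p * q ^ 2 * r) := (hp.mul (hq.pow 2)).mul hr
  rw [← hu.dvd_mul_left]
  refine ⟨a ^ 2 * p * p' * q ^ 2 * q' + p * r * b * (2 * a * p' * r * b * s + b ^ 2 * s ^ 3)
    + a ^ 2 * b * p' ^ 2 * q ^ 3 + a * b * p' ^ 2 * r ^ 2 * e, ?_⟩
  linear_combination a * p * p' * q ^ 2 * hr' +
    p * r * b * (q' * q + a * p' * r + b * s ^ 2) * hq' + a * b * p' ^ 2 * q ^ 2 * hp' -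
    a * b * p' ^ 2 * r ^ 2 * h

theorem IsLocalRing.isUnit_add_of_not_isUnit {A : Type*} [CommRing A] [IsLocalRing A] {u m : A}
    (hu : IsUnit u) (hm : ¬ IsUnit m) : IsUnit (u + m) := by
  by_contra h
  have := IsLocalRing.nonunits_add (a := u + m) (b := -m) h (by simpa using hm)
  simp [hu] at this

variable {A F : Type*} [CommRing A] [Field F] {φ : A →+* F} {a b : A} {t : ℕ → F}

namespace IsSomosFour

theorem exists_map_eq (h : IsSomosFour (φ a) (φ b) t) {n : ℕ} {e p q r : A} (he : IsUnit e)
    (h0 : φ e = t n) (h1 : φ p = t (n + 1)) (h2 : φ q = t (n + 2)) (h3 : φ r = t (n + 3)) :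
    ∃ s, φ s = t (n + 4) ∧ s * e = a * r * p + b * q ^ 2 := by
  obtain ⟨s, hs⟩ := he.dvd (a := a * r * p + b * q ^ 2)
  refine ⟨s, mul_right_cancel₀ (h.1 n) ?_, by rw [hs, mul_comm]⟩
  rw [h.2, ← h0, ← h1, ← h2, ← h3, ← map_mul, mul_comm, ← hs]
  simp

/-- The sequence takes values in the local ring up to index `n + 4`, and the three terms in the
middle of the last five are units. -/
def LocalState (φ : A →+* F) (a b : A) (t : ℕ → F) (n : ℕ) : Prop :=
  (∀ k ≤ n + 4, t k ∈ φ.range) ∧ ∃ e p q r s : A, IsUnit p ∧ IsUnit q ∧ IsUnit r ∧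
    φ e = t n ∧ φ p = t (n + 1) ∧ φ q = t (n + 2) ∧ φ r = t (n + 3) ∧ φ s = t (n + 4) ∧
    s * e = a * r * p + b * q ^ 2

variable [IsLocalRing A]

theorem LocalState.next (h : IsSomosFour (φ a) (φ b) t) (ha : IsUnit a) (hb : IsUnit b) {n : ℕ}
    (hn : LocalState φ a b t n) : LocalState φ a b t (n + 1) ∨ LocalState φ a b t (n + 4) := by
  obtain ⟨hk, e, p, q, r, s, hp, hq, hr, h0, h1, h2, h3, h4, hs⟩ := hn
  obtain ⟨p', h5, hp'⟩ := h.exists_map_eq (n := n + 1) hp h1 h2 h3 h4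
  by_cases hsu : IsUnit s
  · refine .inl ⟨fun k hk' => ?_, p, q, r, s, p', hq, hr, hsu, h1, h2, h3, h4, h5, hp'⟩
    rcases (show k ≤ n + 4 ∨ k = n + 5 by lia) with hk' | rfl
    · exact hk k hk'
    · exact ⟨p', h5⟩
  have unit_of {c d u m : A} (hcd : c * d = u + m) (hu : IsUnit u) (hm : s ∣ m) : IsUnit c :=
    isUnit_of_mul_isUnit_left
      (hcd ▸ IsLocalRing.isUnit_add_of_not_isUnit hu fun h => hsu (isUnit_of_dvd_unit hm h))
  have hpu : IsUnit p' := unit_of (hp'.trans (add_comm _ _)) (hb.mul (hr.pow 2))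
    ⟨a * q, by ring⟩
  obtain ⟨q', h6, hq'⟩ := h.exists_map_eq (n := n + 2) hq h2 h3 h4 h5
  have hqu : IsUnit q' := unit_of hq' ((ha.mul hpu).mul hr) ⟨b * s, by ring⟩
  obtain ⟨r', h7, hr'⟩ := h.exists_map_eq (n := n + 3) hr h3 h4 h5 h6
  have hru : IsUnit r' := unit_of (hr'.trans (add_comm _ _)) (hb.mul (hpu.pow 2)) ⟨a * q', by ring⟩
  obtain ⟨s', hs'⟩ := somosFour_dvd hp hq hr hs hp' hq' hr'
  have h8 : φ s' = t (n + 8) := by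
    refine mul_right_cancel₀ (h.1 (n + 4)) ?_
    rw [h.2 (n + 4), ← h4, ← h5, ← h6, ← h7, mul_comm, ← map_mul, ← hs']
    simp
  refine .inr ⟨fun k hk' => ?_, s, p', q', r', s', hpu, hqu, hru, h4, h5, h6, h7, h8,
    by rw [hs', mul_comm]⟩
  rcases (show k ≤ n + 4 ∨ k = n + 5 ∨ k = n + 6 ∨ k = n + 7 ∨ k = n + 8 by lia) with
    hk' | rfl | rfl | rfl | rfl
  exacts [hk k hk', ⟨p', h5⟩, ⟨q', h6⟩, ⟨r', h7⟩, ⟨s', h8⟩]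

theorem mem_range_of_isUnit (h : IsSomosFour (φ a) (φ b) t) (ha : IsUnit a) (hb : IsUnit b)
    {e p q r : A} (he : IsUnit e) (hp : IsUnit p) (hq : IsUnit q) (hr : IsUnit r)
    (h0 : φ e = t 0) (h1 : φ p = t 1) (h2 : φ q = t 2) (h3 : φ r = t 3) (n : ℕ) :
    t n ∈ φ.range := by
  suffices ∃ m ≥ n, LocalState φ a b t m by
    obtain ⟨m, hm, hk, -⟩ := this
    exact hk n (by lia)
  induction n with
  | zero =>
    obtain ⟨s, h4, hs⟩ := h.exists_map_eq (n := 0) he h0 h1 h2 h3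
    refine ⟨0, le_rfl, fun k hk => ?_, e, p, q, r, s, hp, hq, hr, h0, h1, h2, h3, h4, hs⟩
    interval_cases k
    exacts [⟨e, h0⟩, ⟨p, h1⟩, ⟨q, h2⟩, ⟨r, h3⟩, ⟨s, h4⟩]
  | succ n ih =>
    obtain ⟨m, hm, hs⟩ := ih
    rcases hs.next h ha hb with hs | hs
    exacts [⟨m + 1, by lia, hs⟩, ⟨m + 4, by lia, hs⟩]

theorem exists_isUnit_of_xor (h : IsSomosFour (φ a) (φ b) t)
    (hab : IsUnit a ∧ ¬ IsUnit b ∨ IsUnit b ∧ ¬ IsUnit a)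
    {e p q r : A} (he : IsUnit e) (hp : IsUnit p) (hq : IsUnit q) (hr : IsUnit r)
    (h0 : φ e = t 0) (h1 : φ p = t 1) (h2 : φ q = t 2) (h3 : φ r = t 3) (n : ℕ) :
    ∃ u, IsUnit u ∧ φ u = t n := by
  induction n using Nat.strong_induction_on with
  | _ n ih =>
    match n with
    | 0 => exact ⟨e, he, h0⟩
    | 1 => exact ⟨p, hp, h1⟩
    | 2 => exact ⟨q, hq, h2⟩
    | 3 => exact ⟨r, hr, h3⟩
    | n + 4 =>
      obtain ⟨e, he, h0⟩ := ih n (by lia)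
      obtain ⟨p, hp, h1⟩ := ih (n + 1) (by lia)
      obtain ⟨q, hq, h2⟩ := ih (n + 2) (by lia)
      obtain ⟨r, hr, h3⟩ := ih (n + 3) (by lia)
      obtain ⟨s, h4, hs⟩ := h.exists_map_eq he h0 h1 h2 h3
      refine ⟨s, isUnit_of_mul_isUnit_left (y := e) ?_, h4⟩
      rw [hs]
      rcases hab with ⟨ha, hb⟩ | ⟨hb, ha⟩
      · refine IsLocalRing.isUnit_add_of_not_isUnit ((ha.mul hr).mul hp) fun h => hb ?_
        exact isUnit_of_mul_isUnit_left h
      · rw [add_comm]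
        refine IsLocalRing.isUnit_add_of_not_isUnit (hb.mul (hq.pow 2)) fun h => ha ?_
        exact isUnit_of_mul_isUnit_left (isUnit_of_mul_isUnit_left h)

theorem mem_range (h : IsSomosFour (φ a) (φ b) t) (hab : IsUnit a ∨ IsUnit b)
    {e p q r : A} (he : IsUnit e) (hp : IsUnit p) (hq : IsUnit q) (hr : IsUnit r)
    (h0 : φ e = t 0) (h1 : φ p = t 1) (h2 : φ q = t 2) (h3 : φ r = t 3) (n : ℕ) :
    t n ∈ φ.range := by
  by_cases hboth : IsUnit a ∧ IsUnit b
  · exact h.mem_range_of_isUnit hboth.1 hboth.2 he hp hq hr h0 h1 h2 h3 n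
  · obtain ⟨u, -, hu⟩ := h.exists_isUnit_of_xor (by tauto) he hp hq hr h0 h1 h2 h3 n
    exact ⟨u, hu⟩

/-- The values of a Somos-4 sequence are regular at every prime not dividing the initial data
and not dividing both coefficients. -/
theorem exists_mul_eq_of_prime {P F : Type*} [CommRing P] [Field F] {j : P →+* F}
    (hj : Function.Injective j) {a b : P} {t : ℕ → F} (h : IsSomosFour (j a) (j b) t)
    {π : P} (hπ : Prime π) (hab : ¬ π ∣ a ∨ ¬ π ∣ b) {e p q r : P}
    (he : ¬ π ∣ e) (hp : ¬ π ∣ p) (hq : ¬ π ∣ q) (hr : ¬ π ∣ r)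
    (h0 : j e = t 0) (h1 : j p = t 1) (h2 : j q = t 2) (h3 : j r = t 3) (n : ℕ) :
    ∃ u v : P, ¬ π ∣ v ∧ t n * j v = j u := by
  have hI : (Ideal.span {π}).IsPrime := (Ideal.span_singleton_prime hπ.ne_zero).2 hπ
  set I := Ideal.span {π}
  have hmem (c : P) : c ∈ I.primeCompl ↔ ¬ π ∣ c := by
    rw [Ideal.mem_primeCompl_iff, Ideal.mem_span_singleton]
  let φ : Localization.AtPrime I →+* F := IsLocalization.lift (M := I.primeCompl) (g := j) fun c => by
    rw [isUnit_iff_ne_zero, Ne, map_eq_zero_iff j hj]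
    intro h
    exact (hmem c).1 c.2 (h ▸ dvd_zero π)
  have hφ (c : P) : φ (algebraMap P _ c) = j c := IsLocalization.lift_eq _ _
  have hu {c : P} (hc : ¬ π ∣ c) : IsUnit (algebraMap P (Localization.AtPrime I) c) :=
    IsLocalization.map_units _ (⟨c, (hmem c).2 hc⟩ : I.primeCompl)
  obtain ⟨w, hw⟩ := IsSomosFour.mem_range (φ := φ) (a := algebraMap P _ a) (b := algebraMap P _ b)
    (by simpa only [hφ] using h) (hab.imp hu hu) (hu he) (hu hp) (hu hq) (hu hr)
    ((hφ e).trans h0) ((hφ p).trans h1) ((hφ q).trans h2) ((hφ r).trans h3) n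
  obtain ⟨⟨u, v⟩, huv⟩ := IsLocalization.surj I.primeCompl w
  refine ⟨u, v, (hmem _).1 v.2, ?_⟩
  rw [← hw, ← hφ, ← hφ, ← map_mul, huv]

end IsSomosFour

end Local

/-- In a factorial domain, an element of an overfield which is regular at every prime not
dividing `d` lies in any subring containing the domain and the inverse of `d`. -/
theorem mem_of_regular_at_primes {P F : Type*} [CommRing P] [IsDomain P]
    [UniqueFactorizationMonoid P] [Field F] {j : P →+* F} (hj : Function.Injective j)
    {S : Subring F} (hS : ∀ c, j c ∈ S) {d : P} (hd0 : d ≠ 0) (hd : (j d)⁻¹ ∈ S) {f : F}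
    (hf₀ : ∃ u v : P, v ≠ 0 ∧ f * j v = j u)
    (hf : ∀ π : P, Prime π → ¬ π ∣ d → ∃ u v : P, ¬ π ∣ v ∧ f * j v = j u) : f ∈ S := by
  have hjz {c : P} (hc : c ≠ 0) : j c ≠ 0 := (map_ne_zero_iff j hj).2 hc
  obtain ⟨u, v, hv, huv⟩ := hf₀
  obtain ⟨v, u, c, hrel, rfl, rfl⟩ :=
    UniqueFactorizationMonoid.exists_reduced_factors v hv u
  have hc : c ≠ 0 := left_ne_zero_of_mul hv
  replace hv : v ≠ 0 := right_ne_zero_of_mul hv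
  replace huv : f * j v = j u := by
    refine mul_left_cancel₀ (hjz hc) ?_
    simp only [map_mul] at huv
    linear_combination huv
  have hprime (π : P) (hπ : Prime π) (hπv : π ∣ v) : π ∣ d := by
    by_contra hπd
    obtain ⟨u', v', hv', huv'⟩ := hf π hπ hπd
    have : u * v' = u' * v := hj <| by
      simp only [map_mul, ← huv, ← huv']
      ring
    have hdvd : π ∣ u * v' := this ▸ hπv.mul_left u'
    exact hπ.not_isUnit (hrel hπv ((hπ.dvd_or_dvd hdvd).resolve_right hv'))
  have hinv : (j v)⁻¹ ∈ S := by
    clear huv hrel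
    induction v using UniqueFactorizationMonoid.induction_on_prime with
    | h₁ => exact absurd rfl hv
    | h₂ w hw =>
      obtain ⟨w', hw'⟩ := hw.dvd (a := (1 : P))
      have : (j w)⁻¹ = j w' := inv_eq_of_mul_eq_one_right (by rw [← map_mul, ← hw', map_one])
      exact this ▸ hS w'
    | h₃ w π hw hπ ih =>
      rw [map_mul, mul_inv]
      refine S.mul_mem ?_ (ih hw fun π' h h' => hprime π' h (h'.mul_left _))
      obtain ⟨c, rfl⟩ := hprime π hπ (dvd_mul_right _ _)
      have hcz : j c ≠ 0 := hjz (right_ne_zero_of_mul hd0)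
      have : (j π)⁻¹ = j c * (j (π * c))⁻¹ := by
        rw [map_mul, mul_inv, mul_left_comm, mul_inv_cancel₀ hcz, mul_one]
      exact this ▸ S.mul_mem (hS c) hd
  rw [← mul_inv_cancel_right₀ (hjz hv) f, huv]
  exact S.mul_mem (hS u) hinv

theorem MvPolynomial.not_dvd_X_or_not_dvd_X {σ R : Type*} [CommRing R] [IsDomain R]
    {i k : σ} (hik : i ≠ k) {π : MvPolynomial σ R} (hπ : Prime π) :
    ¬ π ∣ X i ∨ ¬ π ∣ X k := by
  by_contra! h
  have hX : Irreducible (X i : MvPolynomial σ R) := (MvPolynomial.X_prime).irreducible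
  have hdvd : (X i : MvPolynomial σ R) ∣ X k :=
    (hπ.irreducible.dvd_symm hX h.1).trans h.2
  simp_all


/-- Laurent phenomenon for the bilateral Somos-4 recurrence, Section 4.2 of
the paper: over the field `F = ℚ(a,b,x,y,z)` of rational functions in five indeterminates,
there is a unique everywhere-nonzero bilateral Somos-4 sequence with coefficients `a, b` and
initial data `(x, 1, y, z)`, and all of its terms lie in the Laurent polynomial ring
`ℤ[a, b, x±1, y±1, z±1]`. -/
theorem bilateral_somos4_laurent
    (F : Type) [Field F] [Algebra (MvPolynomial (Fin 5) ℚ) F]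
    [IsFractionRing (MvPolynomial (Fin 5) ℚ) F]
    (a b x y z : F)
    (ha : a = algebraMap (MvPolynomial (Fin 5) ℚ) F (MvPolynomial.X 0))
    (hb : b = algebraMap (MvPolynomial (Fin 5) ℚ) F (MvPolynomial.X 1))
    (hx : x = algebraMap (MvPolynomial (Fin 5) ℚ) F (MvPolynomial.X 2))
    (hy : y = algebraMap (MvPolynomial (Fin 5) ℚ) F (MvPolynomial.X 3))
    (hz : z = algebraMap (MvPolynomial (Fin 5) ℚ) F (MvPolynomial.X 4)) :
    (∃! τ : ℤ → F, (∀ n : ℤ, τ n ≠ 0) ∧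
      τ (-1) = x ∧ τ 0 = 1 ∧ τ 1 = y ∧ τ 2 = z ∧
      ∀ n : ℤ, τ (n + 2) * τ (n - 2) = a * τ (n + 1) * τ (n - 1) + b * (τ n) ^ 2) ∧
    (∀ τ : ℤ → F, ((∀ n : ℤ, τ n ≠ 0) ∧
        τ (-1) = x ∧ τ 0 = 1 ∧ τ 1 = y ∧ τ 2 = z ∧
        ∀ n : ℤ, τ (n + 2) * τ (n - 2) = a * τ (n + 1) * τ (n - 1) + b * (τ n) ^ 2) →
      ∀ n : ℤ, τ n ∈
        Subring.closure ({a, b, x, x⁻¹, y, y⁻¹, z, z⁻¹} : Set F)) := by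
  subst ha hb hx hy hz
  set A := algebraMap (MvPolynomial (Fin 5) ℚ) F with hA
  have hinjA : Function.Injective A := IsFractionRing.injective _ _
  have : FaithfulSMul (MvPolynomial (Fin 5) ℚ) F :=
    (faithfulSMul_iff_algebraMap_injective _ _).2 hinjA
  let j : MvPolynomial (Fin 5) ℤ →+* F := A.comp (MvPolynomial.map (Int.castRingHom ℚ))
  have hj : Function.Injective j :=
    hinjA.comp (MvPolynomial.map_injective _ Int.cast_injective)
  have hjX (i : Fin 5) : j (MvPolynomial.X i) = A (MvPolynomial.X i) := by simp [j]
  constructor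
  · obtain ⟨τ, hτ, h0, h1, h2, h3⟩ := exists_isBilateralSomosFour
      (Pos := IsPosAtOne (σ := Fin 5) (F := F)) (fun _ h => h.ne_zero)
      (fun _ _ h h' => h.add h') (fun _ _ h h' => h.mul h') (fun _ _ h h' => h.div h')
      (.algebraMap_X 0) (.algebraMap_X 1) (.algebraMap_X 2) .one (.algebraMap_X 3)
      (.algebraMap_X 4)
    refine ⟨τ, ⟨hτ.1, h0, h1, h2, h3, hτ.2⟩, ?_⟩
    rintro τ' ⟨hne, h0', h1', h2', h3', hrec⟩
    have hτ' : IsBilateralSomosFour _ _ τ' := ⟨hne, hrec⟩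
    funext n
    rcases le_total (-1) n with hn | hn
    · obtain ⟨k, rfl⟩ := Int.exists_add_of_le hn
      exact (hτ'.shift (-1)).eq_of_initial (hτ.shift (-1)) (by simp [*]) (by simp [*])
        (by simp [*]) (by simp [*]) k
    · obtain ⟨k, hk⟩ := Int.exists_add_of_le (show -2 ≤ -n by lia)
      have := (hτ'.reflect.shift (-2)).eq_of_initial (hτ.reflect.shift (-2)) (by simp [*])
        (by simp [*]) (by simp [*]) (by simp [*]) k
      simpa only [← hk, neg_neg] using this
  rintro τ ⟨hne, h0, h1, h2, h3, hrec⟩ n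
  set S := Subring.closure ({A (.X 0), A (.X 1), A (.X 2), (A (.X 2))⁻¹, A (.X 3), (A (.X 3))⁻¹,
    A (.X 4), (A (.X 4))⁻¹} : Set F)
  have hτ : IsBilateralSomosFour (j (.X 0)) (j (.X 1)) τ := by
    rw [hjX, hjX]
    exact ⟨hne, hrec⟩
  have hS (c : MvPolynomial (Fin 5) ℤ) : j c ∈ S := by
    induction c using MvPolynomial.induction_on with
    | C m => simp [j]
    | add p q hp hq => simpa only [map_add] using S.add_mem hp hq
    | mul_X p i hp =>
      rw [map_mul, hjX]
      refine S.mul_mem hp (Subring.subset_closure ?_)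
      fin_cases i <;> simp
  have hd : (j (.X 2 * .X 3 * .X 4))⁻¹ ∈ S := by
    simp only [map_mul, mul_inv, hjX]
    refine S.mul_mem (S.mul_mem ?_ ?_) ?_ <;> exact Subring.subset_closure (by simp)
  have hregular (π : MvPolynomial (Fin 5) ℤ) (hπ : Prime π) (hπd : ¬ π ∣ .X 2 * .X 3 * .X 4) :
      ∃ u v, ¬ π ∣ v ∧ τ n * j v = j u := by
    have hab := MvPolynomial.not_dvd_X_or_not_dvd_X (show (0 : Fin 5) ≠ 1 by decide) hπ
    simp only [hπ.dvd_mul, not_or] at hπd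
    obtain ⟨⟨hx, hy⟩, hz⟩ := hπd
    have hone : ¬ π ∣ 1 := hπ.not_dvd_one
    rcases le_total (-1) n with hn | hn
    · obtain ⟨k, rfl⟩ := Int.exists_add_of_le hn
      exact (hτ.shift (-1)).exists_mul_eq_of_prime hj hπ hab hx hone hy hz (by simp [*])
        (by simp [*]) (by simp [*]) (by simp [*]) k
    · obtain ⟨k, hk⟩ := Int.exists_add_of_le (show -2 ≤ -n by lia)
      have := (hτ.reflect.shift (-2)).exists_mul_eq_of_prime hj hπ hab hz hy hone hx (by simp [*])
        (by simp [*]) (by simp [*]) (by simp [*]) k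
      simpa only [← hk, neg_neg] using this
  refine mem_of_regular_at_primes hj hS (by simp) hd ?_ hregular
  have hX0 : Prime (MvPolynomial.X 0 : MvPolynomial (Fin 5) ℤ) := MvPolynomial.X_prime
  obtain ⟨u, v, hv, huv⟩ := hregular _ hX0 (by simp [hX0.dvd_mul])
  exact ⟨u, v, fun h => hv (h ▸ dvd_zero _), huv⟩
end

section
/- Let α, β ∈ ℂ and let τ : ℤ → ℂ with τ_n ≠ 0 for all n satisfy the bilateral Somos-5 recurrence τ_{n+5}·τ_n = α·τ_{n+4}·τ_{n+1} + β·τ_{n+3}·τ_{n+2} for all n ∈ ℤ. Set h_n := τ_{n−1}·τ_{n+2}/(τ_n·τ_{n+1}) and J_n := h_{n−1} + h_n + α·(1/h_{n−1} + 1/h_n) + β/(h_{n−1}·h_n). Then J_n is independent of n (a conserved quantity, denoted J), and the even and odd subsequences Δ⁽¹⁾_n := τ_{2n} and Δ⁽²⁾_n := τ_{2n+1} each satisfy the same bilateral Somos-4 recurrence: Δ_{n+4}·Δ_n = α̃·Δ_{n+3}·Δ_{n+1} + β̃·Δ_{n+2}² for all n ∈ ℤ, where α̃ = β² and β̃ =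 α·(2β² + α·β·J + α³). -/
/-- Algebraic core of the conservation law: if `a b c = α b + β`, then the invariant of `(a, b)`
equals the invariant of `(b, c)`. -/
theorem somos5_invariant_step {K : Type*} [Field K] {α β a b c : K}
    (ha : a ≠ 0) (hb : b ≠ 0) (hc : c ≠ 0) (habc : a * b * c = α * b + β) :
    b + c + α * (1 / b + 1 / c) + β / (b * c) = a + b + α * (1 / a + 1 / b) + β / (a * b) := by
  obtain rfl : β = a * b * c - α * b := by linear_combination -habc
  field_simp
  ring

/-- Algebraic core of the Somos-4 relation for six consecutive ratios `a, b, c, d, e, f`. -/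
theorem somos5_ratio_identity {K : Type*} [Field K] {α β a b c d e f : K}
    (hc : c ≠ 0) (hd : d ≠ 0)
    (habc : a * b * c = α * b + β) (hbcd : b * c * d = α * c + β)
    (hcde : c * d * e = α * d + β) (hdef : d * e * f = α * e + β) :
    a * b * c ^ 2 * d ^ 2 * e * f = β ^ 2 * (c * d) +
      α * (2 * β ^ 2 + α * β * (c + d + α * (1 / c + 1 / d) + β / (c * d)) + α ^ 3) := by
  have hb : b = (α * c + β) / (c * d) := by
    rw [eq_div_iff (mul_ne_zero hc hd), ← hbcd, mul_assoc]
  have he : e = (α * d + β) / (c * d) := by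
    rw [eq_div_iff (mul_ne_zero hc hd), ← hcde, mul_comm]
  calc a * b * c ^ 2 * d ^ 2 * e * f = (a * b * c) * (d * e * f) * (c * d) := by ring
    _ = (α * b + β) * (α * e + β) * (c * d) := by rw [habc, hdef]
    _ = _ := by
      rw [hb, he]
      field_simp
      ring


/-- Lemma 4.7 of the paper: for a nowhere-vanishing bilateral Somos-5
sequence, the quantity `J_n` is a conserved quantity `J`, and the even and odd subsequences
each satisfy the same bilateral Somos-4 recurrence with coefficients `α̃ = β²` and
`β̃ = α(2β² + αβJ + α³)`. -/
theorem somos5_to_somos4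
    (α β : ℂ) (τ : ℤ → ℂ) (hτ : ∀ n : ℤ, τ n ≠ 0)
    (hrec : ∀ n : ℤ, τ (n + 5) * τ n = α * τ (n + 4) * τ (n + 1) + β * τ (n + 3) * τ (n + 2))
    (h J : ℤ → ℂ)
    (hh : ∀ n : ℤ, h n = τ (n - 1) * τ (n + 2) / (τ n * τ (n + 1)))
    (hJ : ∀ n : ℤ, J n =
      h (n - 1) + h n + α * (1 / h (n - 1) + 1 / h n) + β / (h (n - 1) * h n)) :
    (∀ m n : ℤ, J m = J n) ∧
    (∀ n : ℤ, τ (2 * (n + 4)) * τ (2 * n) =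
      β ^ 2 * τ (2 * (n + 3)) * τ (2 * (n + 1)) +
        α * (2 * β ^ 2 + α * β * J 0 + α ^ 3) * (τ (2 * (n + 2))) ^ 2) ∧
    (∀ n : ℤ, τ (2 * (n + 4) + 1) * τ (2 * n + 1) =
      β ^ 2 * τ (2 * (n + 3) + 1) * τ (2 * (n + 1) + 1) +
        α * (2 * β ^ 2 + α * β * J 0 + α ^ 3) * (τ (2 * (n + 2) + 1)) ^ 2) := by
  have h_ne (n : ℤ) : h n ≠ 0 := by
    rw [hh]
    exact div_ne_zero (mul_ne_zero (hτ _) (hτ _)) (mul_ne_zero (hτ _) (hτ _))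
  have ratio (n k : ℤ) : h (n + k) =
      τ (n + (k - 1)) * τ (n + (k + 2)) / (τ (n + k) * τ (n + (k + 1))) := by
    rw [hh, add_sub_assoc, add_assoc, add_assoc]
  have h_rec (n : ℤ) : h (n - 1) * h n * h (n + 1) = α * h n + β := by
    have hr := hrec (n - 2)
    rw [show n - 2 + 5 = n + 3 by ring, show n - 2 + 4 = n + 2 by ring,
      show n - 2 + 3 = n + 1 by ring, show n - 2 + 2 = n by ring,
      show n - 2 + 1 = n - 1 by ring] at hr
    rw [hh (n - 1), hh n, hh (n + 1), show n - 1 - 1 = n - 2 by ring,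
      show n - 1 + 2 = n + 1 by ring, sub_add_cancel, add_sub_cancel_right,
      show n + 1 + 2 = n + 3 by ring, show n + 1 + 1 = n + 2 by ring]
    have h₀ := hτ (n - 1)
    have h₁ := hτ n
    have h₂ := hτ (n + 1)
    have h₃ := hτ (n + 2)
    field_simp
    linear_combination hr
  have J_succ (n : ℤ) : J (n + 1) = J n := by
    rw [hJ, hJ, add_sub_cancel_right]
    exact somos5_invariant_step (h_ne _) (h_ne _) (h_ne _) (h_rec n)
  have J_const (n : ℤ) : J n = J 0 := by
    induction n using Int.induction_on with
    | zero => rfl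
    | succ k ih => rw [J_succ, ih]
    | pred k ih => rw [← ih, ← J_succ, sub_add_cancel]
  have somos4 (n : ℤ) : τ (n + 8) * τ n = β ^ 2 * τ (n + 6) * τ (n + 2) +
      α * (2 * β ^ 2 + α * β * J 0 + α ^ 3) * τ (n + 4) ^ 2 := by
    have h_rec' (k : ℤ) : h (n + (k - 1)) * h (n + k) * h (n + (k + 1)) = α * h (n + k) + β := by
      rw [← add_sub_assoc, ← add_assoc, h_rec]
    have key := somos5_ratio_identity (h_ne (n + 3)) (h_ne (n + 4))
      (h_rec' 2) (h_rec' 3) (h_rec' 4) (h_rec' 5)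
    have hJ4 := hJ (n + 4)
    rw [add_sub_assoc, J_const] at hJ4
    norm_num only at key hJ4
    rw [← hJ4] at key
    have h_cd : h (n + 3) * h (n + 4) * τ (n + 4) ^ 2 = τ (n + 6) * τ (n + 2) := by
      rw [ratio, ratio]
      norm_num only
      have h₃ := hτ (n + 3)
      have h₄ := hτ (n + 4)
      have h₅ := hτ (n + 5)
      field_simp
    have h_prod : h (n + 1) * h (n + 2) * h (n + 3) ^ 2 * h (n + 4) ^ 2 * h (n + 5) * h (n + 6) *
        τ (n + 4) ^ 2 = τ (n + 8) * τ n := by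
      simp only [ratio]
      norm_num only [add_zero]
      have h₁ := hτ (n + 1)
      have h₂ := hτ (n + 2)
      have h₃ := hτ (n + 3)
      have h₄ := hτ (n + 4)
      have h₅ := hτ (n + 5)
      have h₆ := hτ (n + 6)
      have h₇ := hτ (n + 7)
      field_simp
    linear_combination τ (n + 4) ^ 2 * key - h_prod + β ^ 2 * h_cd
  refine ⟨fun m n => (J_const m).trans (J_const n).symm, fun n => ?_, fun n => ?_⟩
  · simp only [mul_add (2 : ℤ)]
    exact somos4 (2 * n)
  · simp only [mul_add (2 : ℤ), add_right_comm _ _ (1 : ℤ)]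
    exact somos4 (2 * n + 1)
end

section
/- Let α, β, x, y, z ∈ ℂ with x, y, z ≠ 0, and let τ : ℤ → ℂ with τ_n ≠ 0 for all n satisfy the bilateral Somos-5 recurrence τ_{n+5}·τ_n = α·τ_{n+4}·τ_{n+1} + β·τ_{n+3}·τ_{n+2} with τ₀ = 1, τ₁ = 1, τ₂ = x, τ₃ = y, τ₄ = z. Then: τ₋₁ = (βx + αy)/z, τ₋₂ = (αβx² + α²xy + βz)/(yz), τ₅ = αz + βxy; the conserved quantity J := h₀ + h₁ + α·(1/h₀ + 1/h₁) + β/(h₀·h₁), where h_n = τ_{n−1}τ_{n+2}/(τ_nτ_{n+1}), equals (y²z + z² + βx³y + αx²z + αx²y²)/(xyz); and the subsequences Δ⁽¹⁾_n := τ_{2n} and Δ⁽²⁾_n := τ_{2n+1} satisfy the bilateral Somos-4 recurrence Δ_{n+4}·Δ_n = α̃·Δ_{n+3}·Δ_{n+1} + β̃·Δ_{n+2}² with α̃ = β² and β̃ = 2αβ² + α²β·(y²z + z² + βx³y + αx²z + αx²y²)/(xyz) + α⁴, with initial values (Δ⁽¹⁾₋₁, Δ⁽¹⁾₀, Δ⁽¹⁾₁,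 Δ⁽¹⁾₂) = ((αβx² + α²xy + βz)/(yz), 1, x, z) and (Δ⁽²⁾₋₁, Δ⁽²⁾₀, Δ⁽²⁾₁, Δ⁽²⁾₂) = ((βx + αy)/z, 1, y, αz + βxy). -/
/-- The ratio `τ_n τ_{n+3} / (τ_{n+1} τ_{n+2})`, which is invariant under the gauge
transformations `τ_n ↦ a bⁿ τ_n`. -/
noncomputable def somosRatio {K : Type*} [Field K] (τ : ℤ → K) (n : ℤ) : K :=
  τ n * τ (n + 3) / (τ (n + 1) * τ (n + 2))

/-- The conserved quantity of the Somos-5 recurrence, in terms of three consecutive ratios. -/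
noncomputable def somosInvariant {K : Type*} [Field K] (α : K) (τ : ℤ → K) (n : ℤ) : K :=
  somosRatio τ n + somosRatio τ (n + 1) + somosRatio τ (n + 2) + α / somosRatio τ (n + 1)

theorem somosRatio_ne_zero {K : Type*} [Field K] {τ : ℤ → K} (hτ : ∀ n, τ n ≠ 0) (n : ℤ) :
    somosRatio τ n ≠ 0 :=
  div_ne_zero (mul_ne_zero (hτ _) (hτ _)) (mul_ne_zero (hτ _) (hτ _))

theorem somosRatio_mul_mul {K : Type*} [Field K] {α β : K} {τ : ℤ → K} (hτ : ∀ n, τ n ≠ 0)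
    (hrec : ∀ n : ℤ, τ (n + 5) * τ n = α * τ (n + 4) * τ (n + 1) + β * τ (n + 3) * τ (n + 2))
    (n : ℤ) :
    somosRatio τ n * somosRatio τ (n + 1) * somosRatio τ (n + 2) =
      α * somosRatio τ (n + 1) + β := by
  have h := hrec n
  have t1 := hτ (n + 1)
  have t2 := hτ (n + 2)
  have t3 := hτ (n + 3)
  have t4 := hτ (n + 4)
  simp only [somosRatio, add_assoc, Int.reduceAdd]
  field_simp
  linear_combination h

theorem somosInvariant_add_one {K : Type*} [Field K] {α β : K} {τ : ℤ → K} (hτ : ∀ n, τ n ≠ 0)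
    (hrec : ∀ n : ℤ, τ (n + 5) * τ n = α * τ (n + 4) * τ (n + 1) + β * τ (n + 3) * τ (n + 2))
    (n : ℤ) :
    somosInvariant α τ (n + 1) = somosInvariant α τ n := by
  have e0 := somosRatio_mul_mul hτ hrec n
  have e1 := somosRatio_mul_mul hτ hrec (n + 1)
  have r1 := somosRatio_ne_zero hτ (n + 1)
  have r2 := somosRatio_ne_zero hτ (n + 2)
  simp only [add_assoc, Int.reduceAdd] at e1
  simp only [somosInvariant, add_assoc, Int.reduceAdd]
  field_simp
  linear_combination e1 - e0

theorem somosInvariant_eq {K : Type*} [Field K] {α β : K} {τ : ℤ → K} (hτ : ∀ n, τ n ≠ 0)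
    (hrec : ∀ n : ℤ, τ (n + 5) * τ n = α * τ (n + 4) * τ (n + 1) + β * τ (n + 3) * τ (n + 2))
    (m n : ℤ) :
    somosInvariant α τ m = somosInvariant α τ n := by
  have h := Function.Periodic.int_mul (f := somosInvariant α τ) (c := 1)
    (somosInvariant_add_one hτ hrec) (m - n) n
  simpa using h

/-- Every second term of a Somos-5 sequence forms a Somos-4 sequence. -/
theorem somos4_of_somos5 {K : Type*} [Field K] {α β : K} {τ : ℤ → K} (hτ : ∀ n, τ n ≠ 0)
    (hrec : ∀ n : ℤ, τ (n + 5) * τ n = α * τ (n + 4) * τ (n + 1) + β * τ (n + 3) * τ (n + 2))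
    (m n : ℤ) :
    τ (n + 8) * τ n = β ^ 2 * τ (n + 6) * τ (n + 2) +
      (2 * α * β ^ 2 + α ^ 2 * β * somosInvariant α τ m + α ^ 4) * τ (n + 4) ^ 2 := by
  have e0 := somosRatio_mul_mul hτ hrec n
  have e1 := somosRatio_mul_mul hτ hrec (n + 1)
  have e2 := somosRatio_mul_mul hτ hrec (n + 2)
  have e3 := somosRatio_mul_mul hτ hrec (n + 3)
  have r3 := somosRatio_ne_zero hτ (n + 3)
  have outer : τ (n + 8) * τ n = somosRatio τ n * somosRatio τ (n + 1) * somosRatio τ (n + 2) *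
      (somosRatio τ (n + 3) * somosRatio τ (n + 4) * somosRatio τ (n + 5)) *
      (somosRatio τ (n + 2) * somosRatio τ (n + 3)) * τ (n + 4) ^ 2 := by
    have t1 := hτ (n + 1)
    have t2 := hτ (n + 2)
    have t3 := hτ (n + 3)
    have t4 := hτ (n + 4)
    have t5 := hτ (n + 5)
    have t6 := hτ (n + 6)
    have t7 := hτ (n + 7)
    simp only [somosRatio, add_assoc, Int.reduceAdd]
    field_simp
  have inner : τ (n + 6) * τ (n + 2) =
      somosRatio τ (n + 2) * somosRatio τ (n + 3) * τ (n + 4) ^ 2 := by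
    have t3 := hτ (n + 3)
    have t4 := hτ (n + 4)
    have t5 := hτ (n + 5)
    simp only [somosRatio, add_assoc, Int.reduceAdd]
    field_simp
  simp only [add_assoc, Int.reduceAdd] at e1 e2 e3
  rw [outer, mul_assoc (β ^ 2), inner, e0, e3, somosInvariant_eq hτ hrec m (n + 2)]
  simp only [somosInvariant, add_assoc, Int.reduceAdd]
  generalize somosRatio τ (n + 1) = a, somosRatio τ (n + 2) = b, somosRatio τ (n + 3) = c,
    somosRatio τ (n + 4) = d at *
  field_simp
  linear_combination τ (n + 4) ^ 2 * c * (α * β + α ^ 2 * d) * e1 +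
    τ (n + 4) ^ 2 * (α * β * c + α ^ 3) * e2


/-- Section 4.3 of the paper: reduction of the initial value problem for the
bilateral Somos-5 recurrence with data `(1, 1, x, y, z)` to two bilateral Somos-4 initial value
problems for the even and odd subsequences. -/
theorem somos5_ivp_reduction
    (α β x y z : ℂ) (hx : x ≠ 0) (hy : y ≠ 0) (hz : z ≠ 0)
    (τ : ℤ → ℂ) (hτ : ∀ n : ℤ, τ n ≠ 0)
    (hrec : ∀ n : ℤ, τ (n + 5) * τ n = α * τ (n + 4) * τ (n + 1) + β * τ (n + 3) * τ (n + 2))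
    (h0 : τ 0 = 1) (h1 : τ 1 = 1) (h2 : τ 2 = x) (h3 : τ 3 = y) (h4 : τ 4 = z)
    (hA hB J βt : ℂ)
    (hhA : hA = τ (-1) * τ 2 / (τ 0 * τ 1))
    (hhB : hB = τ 0 * τ 3 / (τ 1 * τ 2))
    (hJ : J = hA + hB + α * (1 / hA + 1 / hB) + β / (hA * hB))
    (hβt : βt = 2 * α * β ^ 2 +
      α ^ 2 * β * ((y ^ 2 * z + z ^ 2 + β * x ^ 3 * y + α * x ^ 2 * z + α * x ^ 2 * y ^ 2) /
        (x * y * z)) + α ^ 4) :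
    τ (-1) = (β * x + α * y) / z ∧
    τ (-2) = (α * β * x ^ 2 + α ^ 2 * x * y + β * z) / (y * z) ∧
    τ 5 = α * z + β * x * y ∧
    J = (y ^ 2 * z + z ^ 2 + β * x ^ 3 * y + α * x ^ 2 * z + α * x ^ 2 * y ^ 2) / (x * y * z) ∧
    (∀ n : ℤ, τ (2 * (n + 4)) * τ (2 * n) =
      β ^ 2 * τ (2 * (n + 3)) * τ (2 * (n + 1)) + βt * (τ (2 * (n + 2))) ^ 2) ∧
    (∀ n : ℤ, τ (2 * (n + 4) + 1) * τ (2 * n + 1) =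
      β ^ 2 * τ (2 * (n + 3) + 1) * τ (2 * (n + 1) + 1) + βt * (τ (2 * (n + 2) + 1)) ^ 2) ∧
    (τ (2 * (-1 : ℤ)) = (α * β * x ^ 2 + α ^ 2 * x * y + β * z) / (y * z) ∧
      τ (2 * (0 : ℤ)) = 1 ∧ τ (2 * (1 : ℤ)) = x ∧ τ (2 * (2 : ℤ)) = z) ∧
    (τ (2 * (-1 : ℤ) + 1) = (β * x + α * y) / z ∧
      τ (2 * (0 : ℤ) + 1) = 1 ∧ τ (2 * (1 : ℤ) + 1) = y ∧
      τ (2 * (2 : ℤ) + 1) = α * z + β * x * y) := by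
  have hm1 : τ (-1) = (β * x + α * y) / z := by
    have h := hrec (-1)
    norm_num [h0, h1, h2, h3, h4] at h
    rw [eq_div_iff hz]
    linear_combination h
  have hm2 : τ (-2) = (α * β * x ^ 2 + α ^ 2 * x * y + β * z) / (y * z) := by
    have h := hrec (-2)
    norm_num [h0, h1, h2, h3, hm1] at h
    field_simp at h ⊢
    linear_combination h
  have h5 : τ 5 = α * z + β * x * y := by
    have h := hrec 0
    norm_num [h0, h1, h2, h3, h4] at h
    linear_combination h
  have hw : β * x + α * y ≠ 0 := by
    have h := hτ (-1)
    rw [hm1] at h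
    exact (div_ne_zero_iff.mp h).1
  have hinv : somosInvariant α τ (-1) =
      (y ^ 2 * z + z ^ 2 + β * x ^ 3 * y + α * x ^ 2 * z + α * x ^ 2 * y ^ 2) / (x * y * z) := by
    norm_num [somosInvariant, somosRatio, h0, h1, h2, h3, h4, hm1]
    field_simp
    ring
  have hJ' : J =
      (y ^ 2 * z + z ^ 2 + β * x ^ 3 * y + α * x ^ 2 * z + α * x ^ 2 * y ^ 2) / (x * y * z) := by
    rw [hJ, hhA, hhB, h0, h1, h2, h3, hm1]
    field_simp
    ring
  have hβ : βt = 2 * α * β ^ 2 + α ^ 2 * β * somosInvariant α τ (-1) + α ^ 4 := by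
    rw [hβt, hinv]
  refine ⟨hm1, hm2, h5, hJ', fun n => ?_, fun n => ?_, ⟨by simpa using hm2, by simpa using h0,
    by simpa using h2, by simpa using h4⟩, ⟨by simpa using hm1, by simpa using h1,
    by simpa using h3, by simpa using h5⟩⟩
  · rw [hβ]
    rw [show 2 * (n + 4) = 2 * n + 8 by ring, show 2 * (n + 3) = 2 * n + 6 by ring,
      show 2 * (n + 2) = 2 * n + 4 by ring, show 2 * (n + 1) = 2 * n + 2 by ring]
    exact somos4_of_somos5 hτ hrec (-1) (2 * n)
  · rw [hβ]
    rw [show 2 * (n + 4) + 1 = 2 * n + 1 + 8 by ring, show 2 * (n + 3) + 1 = 2 * n + 1 + 6 by ring,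
      show 2 * (n + 2) + 1 = 2 * n + 1 + 4 by ring, show 2 * (n + 1) + 1 = 2 * n + 1 + 2 by ring]
    exact somos4_of_somos5 hτ hrec (-1) (2 * n + 1)
end

section
/- For every n ∈ ℤ: Y_{n+1} ≠ 0, the continued-fraction step Y_n = a_n(t⁻¹) + (Y_{n+1})⁻¹ holds in ℂ((t)), and Y_n − a_n(t⁻¹) has t-adic order ≥ 1 (so a_n is the polynomial part of Y_n in X = t⁻¹; consequently Y_n has the infinite continued fraction expansion ⟨a_n, a_{n+1}, a_{n+2}, …⟩ with linear partial quotients, i.e. Y_n is J-expressible). -/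
theorem LaurentSeries.coeff_aeval_single_neg_one {K : Type*} [Field K] (p : Polynomial K) (k : ℤ) :
    (Polynomial.aeval (HahnSeries.single (-1 : ℤ) (1 : K) : LaurentSeries K) p).coeff (-k) =
      if 0 ≤ k then p.coeff k.toNat else 0 := by
  induction p using Polynomial.induction_on' with
  | add p q hp hq =>
    rw [map_add, HahnSeries.coeff_add, hp, hq, Polynomial.coeff_add]
    split_ifs <;> simp
  | monomial m c =>
    have hc : algebraMap K (LaurentSeries K) c = HahnSeries.C c := by
      simp [RingHom.algebraMap_toAlgebra]
    rw [Polynomial.aeval_monomial, HahnSeries.single_pow, hc,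
      HahnSeries.C_mul_eq_smul, HahnSeries.coeff_smul, HahnSeries.coeff_single,
      Polynomial.coeff_monomial, one_pow]
    have h : (-k = m • (-1 : ℤ)) ↔ (0 ≤ k ∧ m = k.toNat) := by
      rw [nsmul_eq_mul]; omega
    simp only [h]
    split_ifs <;> simp_all

theorem LaurentSeries.coeff_aeval_single_neg_natCast {K : Type*} [Field K] (p : Polynomial K)
    (m : ℕ) :
    (Polynomial.aeval (HahnSeries.single (-1 : ℤ) (1 : K) : LaurentSeries K) p).coeff (-(m : ℤ)) =
      p.coeff m := by
  simp [LaurentSeries.coeff_aeval_single_neg_one]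

theorem LaurentSeries.aeval_single_neg_one_ne_zero {K : Type*} [Field K] {p : Polynomial K}
    (hp : p ≠ 0) :
    Polynomial.aeval (HahnSeries.single (-1 : ℤ) (1 : K) : LaurentSeries K) p ≠ 0 := by
  intro h
  apply hp
  ext m
  rw [← LaurentSeries.coeff_aeval_single_neg_natCast, h]
  simp

theorem LaurentSeries.neg_natDegree_le_order_aeval {K : Type*} [Field K] {p : Polynomial K}
    (hp : p ≠ 0) :
    -(p.natDegree : ℤ) ≤
      (Polynomial.aeval (HahnSeries.single (-1 : ℤ) (1 : K) : LaurentSeries K) p).order := by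
  have h := HahnSeries.coeff_order_eq_zero.not.mpr (LaurentSeries.aeval_single_neg_one_ne_zero hp)
  rw [← neg_neg (HahnSeries.order _), LaurentSeries.coeff_aeval_single_neg_one] at h
  split_ifs at h with h0
  · have := Polynomial.le_natDegree_of_ne_zero h
    omega
  · exact absurd rfl h

/-- Lemma A.1 of the paper, general hyperelliptic curves of genus `g`: the
hyperelliptic functions `Y_n` satisfy the forward continued-fraction recursion with linear
partial quotients `a_n`, so each `Y_n` is J-expressible. -/
theorem genus_g_forward_cf
    (g : ℕ) (hg : 1 ≤ g) (u : ℂ) (hu : u ≠ 0)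
    (A R : Polynomial ℂ)
    (hA : A.Monic) (hAdeg : A.natDegree = g + 1)
    (hRdeg : R.natDegree = g) (hRlead : R.leadingCoeff = u)
    (hns : ¬ ∃ p : Polynomial ℂ, A ^ 2 + 4 * R = p ^ 2)
    (Y : LaurentSeries ℂ)
    (hY : Y ^ 2 = Polynomial.aeval
      (HahnSeries.single (-1 : ℤ) (1 : ℂ) : LaurentSeries ℂ) (A ^ 2 + 4 * R))
    (hYnorm : ((HahnSeries.single ((g : ℤ) + 1) (1 : ℂ) : LaurentSeries ℂ) * Y).coeff 0 = 1)
    (P Q : ℤ → Polynomial ℂ) (uu ρ : ℤ → ℂ) (a : ℤ → Polynomial ℂ)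
    (hPdeg : ∀ n : ℤ, (P n - A).degree ≤ ((g : ℕ) - 1 : ℕ))
    (hQdeg : ∀ n : ℤ, (Q n).natDegree = g)
    (hQlead : ∀ n : ℤ, (Q n).coeff g = uu n)
    (huu : ∀ n : ℤ, uu n ≠ 0)
    (hρ : ∀ n : ℤ, ρ n = (Q n).coeff (g - 1) / uu n)
    (ha : ∀ n : ℤ, a n = Polynomial.C (2 / uu n) * (Polynomial.X - Polynomial.C (ρ n)))
    (hPiter : ∀ n : ℤ, P (n + 1) = a n * Q n - P n)
    (hQiter : ∀ n : ℤ, Q (n + 1) = Q (n - 1) + 2 * a n * P n - (a n) ^ 2 * Q n)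
    (hcons : ∀ n : ℤ, (P n) ^ 2 + Q n * Q (n - 1) = A ^ 2 + 4 * R)
    (Yseq Ytil Ystar : ℤ → LaurentSeries ℂ)
    (hYseq : ∀ n : ℤ, Yseq n =
      (Y + Polynomial.aeval (HahnSeries.single (-1 : ℤ) (1 : ℂ) : LaurentSeries ℂ) (P n)) /
        Polynomial.aeval (HahnSeries.single (-1 : ℤ) (1 : ℂ) : LaurentSeries ℂ) (Q n))
    (hYtil : ∀ n : ℤ, Ytil n =
      (Y + Polynomial.aeval (HahnSeries.single (-1 : ℤ) (1 : ℂ) : LaurentSeries ℂ) (P n)) /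
        Polynomial.aeval (HahnSeries.single (-1 : ℤ) (1 : ℂ) : LaurentSeries ℂ) (Q (n - 1)))
    (hYstar : ∀ n : ℤ, Ystar n =
      (-Y + Polynomial.aeval (HahnSeries.single (-1 : ℤ) (1 : ℂ) : LaurentSeries ℂ) (P n)) /
        Polynomial.aeval (HahnSeries.single (-1 : ℤ) (1 : ℂ) : LaurentSeries ℂ) (Q n))
    :
    ∀ n : ℤ, Yseq (n + 1) ≠ 0 ∧
      Yseq n = Polynomial.aeval (HahnSeries.single (-1 : ℤ) (1 : ℂ) : LaurentSeries ℂ) (a n) +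
        (Yseq (n + 1))⁻¹ ∧
      (∀ k : ℤ, k ≤ 0 →
        (Yseq n - Polynomial.aeval (HahnSeries.single (-1 : ℤ) (1 : ℂ) : LaurentSeries ℂ)
          (a n)).coeff k = 0) := by
  intro n
  have hQ0 : ∀ m, Q m ≠ 0 := fun m h => huu m (by rw [← hQlead m, h, Polynomial.coeff_zero])
  have hAlead : A.coeff (g + 1) = 1 := by rw [← hAdeg]; exact hA
  have hPlead : (P (n + 1)).coeff (g + 1) = 1 := by
    have h : (P (n + 1) - A).coeff (g + 1) = 0 :=
      Polynomial.coeff_eq_zero_of_degree_lt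
        ((hPdeg (n + 1)).trans_lt (by exact_mod_cast (by omega : g - 1 < g + 1)))
    rw [Polynomial.coeff_sub, hAlead] at h
    exact sub_eq_zero.mp h
  have hYlead : Y.coeff (-((g + 1 : ℕ) : ℤ)) = 1 := by
    have h := HahnSeries.coeff_single_mul_add (r := (1 : ℂ)) (x := Y)
      (a := -((g + 1 : ℕ) : ℤ)) (b := (g : ℤ) + 1)
    rw [one_mul] at h
    rw [show -((g + 1 : ℕ) : ℤ) + ((g : ℤ) + 1) = 0 by omega, hYnorm] at h
    exact h.symm
  have hcons' := hcons (n + 1)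
  rw [add_sub_cancel_right] at hcons'
  have hsq := hY
  rw [← hcons', map_add, map_pow, map_mul] at hsq
  have hPn := congrArg
    (Polynomial.aeval (HahnSeries.single (-1 : ℤ) (1 : ℂ) : LaurentSeries ℂ)) (hPiter n)
  rw [map_sub, map_mul] at hPn
  have hsum : (Y + Polynomial.aeval (HahnSeries.single (-1 : ℤ) (1 : ℂ) : LaurentSeries ℂ)
      (P (n + 1))).coeff (-((g + 1 : ℕ) : ℤ)) ≠ 0 := by
    rw [HahnSeries.coeff_add, LaurentSeries.coeff_aeval_single_neg_natCast, hYlead, hPlead]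
    norm_num
  have hD0 : Y + Polynomial.aeval (HahnSeries.single (-1 : ℤ) (1 : ℂ) : LaurentSeries ℂ)
      (P (n + 1)) ≠ 0 := fun h => hsum (by rw [h, HahnSeries.coeff_zero])
  have hDord := HahnSeries.order_le_of_coeff_ne_zero hsum
  have hq := LaurentSeries.aeval_single_neg_one_ne_zero (hQ0 n)
  have hq' := LaurentSeries.aeval_single_neg_one_ne_zero (hQ0 (n + 1))
  have hqord := LaurentSeries.neg_natDegree_le_order_aeval (hQ0 (n + 1))
  rw [hQdeg] at hqord
  have hne : Yseq (n + 1) ≠ 0 := by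
    rw [hYseq]
    exact div_ne_zero hD0 hq'
  have hstep : Yseq n =
      Polynomial.aeval (HahnSeries.single (-1 : ℤ) (1 : ℂ) : LaurentSeries ℂ) (a n) +
        (Yseq (n + 1))⁻¹ := by
    rw [hYseq n, hYseq (n + 1), inv_div, div_eq_iff hq, add_mul, div_mul_eq_mul_div,
      ← sub_eq_iff_eq_add', eq_div_iff hD0]
    linear_combination hsq + (Y + Polynomial.aeval
      (HahnSeries.single (-1 : ℤ) (1 : ℂ) : LaurentSeries ℂ) (P (n + 1))) * hPn
  refine ⟨hne, hstep, fun k hk => ?_⟩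
  rw [hstep, add_sub_cancel_left]
  apply HahnSeries.coeff_eq_zero_of_lt_order
  have hmul : (Yseq (n + 1))⁻¹ * (Y + Polynomial.aeval
      (HahnSeries.single (-1 : ℤ) (1 : ℂ) : LaurentSeries ℂ) (P (n + 1))) =
      Polynomial.aeval (HahnSeries.single (-1 : ℤ) (1 : ℂ) : LaurentSeries ℂ) (Q (n + 1)) := by
    rw [hYseq (n + 1), inv_div, div_mul_cancel₀ _ hD0]
  rw [← hmul, HahnSeries.order_mul (inv_ne_zero hne) hD0] at hqord
  omega
end
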